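/- The Riemann Hypothesis holds if and only if the closure in H² of 𝒩, the linear span of {h_k : k ≥ 2}, is invariant under the shift operator S (where (Sf)(ω) = ω·f(ω)). -/

import Mathlib

open MeasureTheory Complex

noncomputable section

/-- Normalized Lebesgue (arc-length) measure on the unit circle, as a measure on `ℂ`. -/
def mCirc : Measure ℂ :=
  (ENNReal.ofReal (2 * Real.pi))⁻¹ •
    Measure.map (fun θ : ℝ => Complex.exp (θ * Complex.I))
      (volume.restrict (Set.Ioc 0 (2 * Real.pi)))

/-- `g_k(z) = Log(1 - z^k) - Log(1 - z) - log k`. -/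
def gFun (k : ℕ) (z : ℂ) : ℂ :=
  Complex.log (1 - z ^ k) - Complex.log (1 - z) - (Real.log k : ℂ)

/-- `h_k(z) = g_k(z) / (1 - z)`. -/
def hFun (k : ℕ) (z : ℂ) : ℂ := gFun k z / (1 - z)

/-- The Hardy space `H²`, viewed as the set of elements of `L²(𝕋, m)` whose negative
Fourier coefficients vanish. -/
def H2 : Set (Lp ℂ 2 mCirc) :=
  {f | ∀ n : ℤ, n < 0 → (∫ ω : ℂ, f ω * ω ^ (-n) ∂mCirc) = 0}

end

lemma norm_ofReal_cpow_neg_sub_le {a x : ℝ} (ha : 0 < a) (hx : x ∈ Set.Icc a (a + 1)) {s : ℂ}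
    (hs : -1 ≤ s.re) : ‖(x : ℂ) ^ (-s) - (a : ℂ) ^ (-s)‖ ≤ ‖s‖ * a ^ (-s.re - 1) := by
  rcases eq_or_ne s 0 with rfl | hs0
  · simp
  have key := Convex.norm_image_sub_le_of_norm_hasDerivWithin_le
    (f := fun y : ℝ => (y : ℂ) ^ (-s)) (f' := fun y : ℝ => -s * (y : ℂ) ^ (-s - 1))
    (s := Set.Icc a (a + 1)) (x := a) (y := x) (C := ‖s‖ * a ^ (-s.re - 1)) ?_ ?_
    (convex_Icc _ _) (by simp) hx
  · refine key.trans (mul_le_of_le_one_right (by positivity) ?_)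
    rw [Real.norm_eq_abs, abs_le]
    constructor <;> linarith [hx.1, hx.2]
  · intro y hy
    exact (hasDerivAt_ofReal_cpow_const (by linarith [hy.1]) (neg_ne_zero.2 hs0)).hasDerivWithinAt
  · intro y hy
    rw [norm_mul, norm_neg, norm_cpow_eq_rpow_re_of_pos (by linarith [hy.1])]
    gcongr
    simp only [sub_re, neg_re, one_re]
    exact Real.rpow_le_rpow_of_nonpos ha hy.1 (by linarith)

lemma norm_natCast_cpow_neg_sub_le {n : ℕ} (hn : 0 < n) {s : ℂ} (hs : -1 ≤ s.re) :
    ‖(n : ℂ) ^ (-s) - ((n : ℂ) + 1) ^ (-s)‖ ≤ ‖s‖ * (n : ℝ) ^ (-s.re - 1) := by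
  have := norm_ofReal_cpow_neg_sub_le (a := n) (x := n + 1) (by exact_mod_cast hn) (by simp) hs
  rw [norm_sub_rev]
  simpa using this

/-- The Euler–Maclaurin remainder terms of `(s - 1) ζ(s)`. -/
noncomputable def zetaRemainder (n : ℕ) (s : ℂ) : ℂ :=
  (s - 1) * (n : ℂ) ^ (-s) - ((n : ℂ) ^ (1 - s) - ((n : ℂ) + 1) ^ (1 - s))

lemma norm_zetaRemainder_le {n : ℕ} (hn : 0 < n) {s : ℂ} (hs : -1 ≤ s.re) :
    ‖zetaRemainder n s‖ ≤ ‖s‖ * ‖s - 1‖ * (n : ℝ) ^ (-s.re - 1) := by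
  rcases eq_or_ne s 1 with rfl | hs1
  · simp [zetaRemainder]
  have hn' : (0 : ℝ) < n := by exact_mod_cast hn
  have h1s : 1 - s ≠ 0 := sub_ne_zero.2 hs1.symm
  have key := Convex.norm_image_sub_le_of_norm_hasDerivWithin_le
    (f := fun y : ℝ => (y : ℂ) ^ (1 - s) + (s - 1) * (n : ℂ) ^ (-s) * y)
    (f' := fun y : ℝ => (1 - s) * (y : ℂ) ^ (1 - s - 1) + (s - 1) * (n : ℂ) ^ (-s) * 1)
    (s := Set.Icc (n : ℝ) (n + 1)) (x := n) (y := n + 1)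
    (C := ‖s‖ * ‖s - 1‖ * (n : ℝ) ^ (-s.re - 1)) ?_ ?_
    (convex_Icc _ _) (by simp) (by simp)
  · simp only [add_sub_cancel_left, norm_one, mul_one] at key
    refine le_trans (le_of_eq ?_) key
    congr 1
    unfold zetaRemainder
    push_cast
    ring
  · intro y hy
    refine ((hasDerivAt_ofReal_cpow_const (by linarith [hy.1]) h1s).add ?_).hasDerivWithinAt
    exact (hasDerivAt_id y).ofReal_comp.const_mul _
  · intro y hy
    have := norm_ofReal_cpow_neg_sub_le hn' hy hs
    calc _ = ‖(s - 1) * -((y : ℂ) ^ (-s) - ((n : ℝ) : ℂ) ^ (-s))‖ := by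
            congr 1
            rw [show 1 - s - 1 = -s by ring]
            push_cast
            ring
      _ ≤ ‖s - 1‖ * (‖s‖ * (n : ℝ) ^ (-s.re - 1)) := by
            rw [norm_mul, norm_neg]; gcongr
      _ = _ := by ring

lemma tendsto_natCast_add_one_cpow_neg {s : ℂ} (hs : 0 < s.re) :
    Filter.Tendsto (fun n : ℕ => ((n : ℂ) + 1) ^ (-s)) Filter.atTop (nhds 0) := by
  rw [tendsto_zero_iff_norm_tendsto_zero]
  have h : ∀ n : ℕ, ‖((n : ℂ) + 1) ^ (-s)‖ = ((n : ℝ) + 1) ^ (-s.re) := by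
    intro n
    have := norm_cpow_eq_rpow_re_of_pos (x := (n : ℝ) + 1) (by positivity) (-s)
    simpa using this
  simp_rw [h]
  exact (tendsto_rpow_neg_atTop hs).comp
    (Filter.tendsto_atTop_add_const_right _ 1 tendsto_natCast_atTop_atTop)

lemma hasSum_cpow_sub_cpow_succ {s : ℂ} (hs : 0 < s.re)
    (hsum : Summable fun n : ℕ => ((n : ℂ) + 1) ^ (-s) - ((n : ℂ) + 2) ^ (-s)) :
    HasSum (fun n : ℕ => ((n : ℂ) + 1) ^ (-s) - ((n : ℂ) + 2) ^ (-s)) 1 := by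
  have h := hsum.hasSum
  have h2 : Filter.Tendsto (fun N : ℕ => 1 - ((N : ℂ) + 1) ^ (-s)) Filter.atTop (nhds (1 - 0)) :=
    tendsto_const_nhds.sub (tendsto_natCast_add_one_cpow_neg hs)
  have h3 : ∀ N : ℕ, ∑ n ∈ Finset.range N, (((n : ℂ) + 1) ^ (-s) - ((n : ℂ) + 2) ^ (-s))
      = 1 - ((N : ℂ) + 1) ^ (-s) := by
    intro N
    induction N with
    | zero => simp
    | succ N ih =>
      rw [Finset.sum_range_succ, ih]
      push_cast
      rw [show (N : ℂ) + 1 + 1 = N + 2 by ring]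
      ring
  have h4 := h.tendsto_sum_nat
  simp_rw [h3] at h4
  have := tendsto_nhds_unique h4 h2
  rwa [this, sub_zero] at h

lemma summable_nat_add_one_rpow {p : ℝ} (hp : p < -1) :
    Summable fun n : ℕ => ((n : ℝ) + 1) ^ p := by
  have := (summable_nat_add_iff 1).2 (Real.summable_nat_rpow.2 hp)
  simpa using this

lemma natCast_add_one_cpow_norm (n : ℕ) (s : ℂ) :
    ‖((n : ℂ) + 1) ^ s‖ = ((n : ℝ) + 1) ^ s.re := by
  have := norm_cpow_eq_rpow_re_of_pos (x := (n : ℝ) + 1) (by positivity) s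
  simpa using this

lemma hasSum_zeta {s : ℂ} (hs : 1 < s.re) :
    HasSum (fun n : ℕ => ((n : ℂ) + 1) ^ (-s)) (riemannZeta s) := by
  have h : Summable fun n : ℕ => ((n : ℂ) + 1) ^ (-s) := by
    apply Summable.of_norm
    simp_rw [natCast_add_one_cpow_norm]
    exact summable_nat_add_one_rpow (by simpa using hs)
  rw [zeta_eq_tsum_one_div_nat_add_one_cpow hs]
  convert h.hasSum using 1
  simp [cpow_neg]

lemma zeta₁_eq_of_one_lt {s : ℂ} (hs : 1 < s.re) :
    riemannZeta₁ s = 1 + ∑' n : ℕ, zetaRemainder (n + 1) s := by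
  have hne : s ≠ 1 := by rintro rfl; simp at hs
  have h1 := (hasSum_zeta hs).mul_left (s - 1)
  have hr : Summable fun n : ℕ => zetaRemainder (n + 1) s := by
    refine Summable.of_norm_bounded (g := fun n : ℕ => ‖s‖ * ‖s - 1‖ * ((n : ℝ) + 1) ^ (-s.re - 1))
      ((summable_nat_add_one_rpow (by linarith)).mul_left _) fun n => ?_
    have := norm_zetaRemainder_le (n := n + 1) (by omega) (s := s) (by linarith)
    simpa using this
  have h2 : Summable fun n : ℕ => ((n : ℂ) + 1) ^ (-(s - 1)) - ((n : ℂ) + 2) ^ (-(s - 1)) := by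
    refine (h1.summable.sub hr).congr fun n => ?_
    rw [zetaRemainder]
    push_cast
    rw [show (n : ℂ) + 1 + 1 = n + 2 by ring, neg_sub]
    ring
  have h3 := hasSum_cpow_sub_cpow_succ (s := s - 1) (by simpa using hs) h2
  have h4 := (h1.sub h3).tsum_eq
  have h5 : riemannZeta₁ s = (s - 1) * riemannZeta s := by
    rw [riemannZeta_eq_inv_sub_mul hne, mul_inv_cancel_left₀ (sub_ne_zero.2 hne)]
  rw [h5, ← sub_eq_iff_eq_add', ← h4]
  refine tsum_congr fun n => ?_
  rw [zetaRemainder]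
  push_cast
  rw [show (n : ℂ) + 1 + 1 = n + 2 by ring, neg_sub]

lemma differentiable_natCast_add_one_cpow (n : ℕ) (a b : ℂ) :
    Differentiable ℂ fun s : ℂ => ((n : ℂ) + 1) ^ (a + b * s) := by
  intro s
  refine DifferentiableAt.const_cpow (by fun_prop) (Or.inl ?_)
  exact_mod_cast Nat.succ_ne_zero n

/-- A half plane cut by a large ball. -/
def cutHalfPlane (a R : ℝ) : Set ℂ := {s | a < s.re} ∩ Metric.ball 0 R

lemma isOpen_cutHalfPlane (a R : ℝ) : IsOpen (cutHalfPlane a R) :=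
  (isOpen_lt continuous_const continuous_re).inter Metric.isOpen_ball

lemma convex_cutHalfPlane (a R : ℝ) : Convex ℝ (cutHalfPlane a R) :=
  (convex_halfSpace_re_gt a).inter (convex_ball 0 R)

lemma eqOn_cutHalfPlane {f g : ℂ → ℂ} {a R b : ℝ} (hf : DifferentiableOn ℂ f (cutHalfPlane a R))
    (hg : DifferentiableOn ℂ g (cutHalfPlane a R)) (hb : max a b + 1 + |a| + |b| < R)
    (h : ∀ s : ℂ, b < s.re → f s = g s) : Set.EqOn f g (cutHalfPlane a R) := by
  have ho := isOpen_cutHalfPlane a R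
  refine AnalyticOnNhd.eqOn_of_preconnected_of_eventuallyEq (hf.analyticOnNhd ho)
    (hg.analyticOnNhd ho) (convex_cutHalfPlane a R).isPreconnected
    (z₀ := ((max a b + 1 : ℝ) : ℂ)) ?_ ?_
  · refine ⟨?_, ?_⟩
    · simp only [Set.mem_ofPred_eq, ofReal_re]
      linarith [le_max_left a b]
    · rw [mem_ball_zero_iff, norm_real, Real.norm_eq_abs, abs_lt]
      constructor
      · linarith [le_max_left a b, le_max_right a b, neg_abs_le a, neg_abs_le b]
      · linarith [abs_nonneg a, abs_nonneg b]
  · have : {s : ℂ | b < s.re} ∈ nhds ((max a b + 1 : ℝ) : ℂ) := by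
      refine (isOpen_lt continuous_const continuous_re).mem_nhds ?_
      simp only [Set.mem_ofPred_eq, ofReal_re]
      linarith [le_max_right a b]
    filter_upwards [this] with s hs using h s hs

lemma zeta₁_eq {s : ℂ} (hs : 0 < s.re) :
    riemannZeta₁ s = 1 + ∑' n : ℕ, zetaRemainder (n + 1) s := by
  set a := s.re / 2
  set R := ‖s‖ + max a 1 + 1 + |a| + |1| + 1
  have ha : 0 < a := by positivity
  refine eqOn_cutHalfPlane (a := a) (R := R) (b := 1) (f := riemannZeta₁)
    (g := fun s => 1 + ∑' n : ℕ, zetaRemainder (n + 1) s)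
    differentiable_riemannZeta₁.differentiableOn ?_ ?_ (fun s hs => zeta₁_eq_of_one_lt hs) ?_
  · refine (differentiableOn_const _).add (differentiableOn_tsum_of_summable_norm
      (u := fun n : ℕ => R * (R + 1) * ((n : ℝ) + 1) ^ (-a - 1))
      ((summable_nat_add_one_rpow (by linarith)).mul_left _) (fun n => ?_)
      (isOpen_cutHalfPlane _ _) (fun n w hw => ?_))
    · have h1 := differentiable_natCast_add_one_cpow n 0 (-1)
      have h2 := differentiable_natCast_add_one_cpow n 1 (-1)
      have h3 := differentiable_natCast_add_one_cpow (n + 1) 1 (-1)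
      refine Differentiable.differentiableOn ?_
      have h4 : zetaRemainder (n + 1) = fun w => (w - 1) * ((n : ℂ) + 1) ^ (0 + -1 * w) -
          (((n : ℂ) + 1) ^ (1 + -1 * w) - (((n + 1 : ℕ) : ℂ) + 1) ^ (1 + -1 * w)) := by
        ext w
        simp [zetaRemainder, sub_eq_add_neg]
      change Differentiable ℂ (zetaRemainder (n + 1))
      rw [h4]
      fun_prop
    · have hw1 : a < w.re := hw.1
      have hw2 : ‖w‖ < R := by simpa using hw.2
      have := norm_zetaRemainder_le (n := n + 1) (by omega) (s := w) (by linarith)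
      refine this.trans ?_
      push_cast
      have h3 : ‖w - 1‖ ≤ R + 1 := (norm_sub_le _ _).trans (by simpa using hw2.le)
      have h4 : ((n : ℝ) + 1) ^ (-w.re - 1) ≤ ((n : ℝ) + 1) ^ (-a - 1) :=
        Real.rpow_le_rpow_of_exponent_le (by linarith [n.cast_nonneg (α := ℝ)]) (by linarith)
      have : 0 < R := (norm_nonneg _).trans_lt hw2
      gcongr
  · have := norm_nonneg s
    simp only [R]
    linarith
  · refine ⟨?_, ?_⟩
    · simp only [Set.mem_ofPred_eq, a]; linarith
    · simp only [mem_ball_zero_iff, R]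
      linarith [abs_nonneg a, abs_nonneg (1 : ℝ), le_max_right a 1]

/-- Polynomial growth of `(s - 1) ζ(s)` in half planes to the right of the imaginary axis. -/
lemma exists_norm_zeta₁_le {a : ℝ} (ha : 0 < a) :
    ∃ C : ℝ, 1 ≤ C ∧ ∀ s : ℂ, a ≤ s.re → ‖riemannZeta₁ s‖ ≤ C * (1 + ‖s‖) ^ 2 := by
  set T := ∑' n : ℕ, ((n : ℝ) + 1) ^ (-a - 1)
  have hT : Summable fun n : ℕ => ((n : ℝ) + 1) ^ (-a - 1) :=
    summable_nat_add_one_rpow (by linarith)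
  have hT0 : 0 ≤ T := tsum_nonneg fun n => by positivity
  refine ⟨1 + T, by linarith, fun s hs => ?_⟩
  rw [zeta₁_eq (by linarith)]
  have h1 : ‖∑' n : ℕ, zetaRemainder (n + 1) s‖ ≤ ‖s‖ * (‖s‖ + 1) * T := by
    rw [← tsum_mul_left]
    refine tsum_of_norm_bounded (hT.mul_left _).hasSum fun n => ?_
    refine (norm_zetaRemainder_le (n := n + 1) (by omega) (s := s) (by linarith)).trans ?_
    push_cast
    have h3 : ‖s - 1‖ ≤ ‖s‖ + 1 := (norm_sub_le _ _).trans (by simp)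
    have h4 : ((n : ℝ) + 1) ^ (-s.re - 1) ≤ ((n : ℝ) + 1) ^ (-a - 1) :=
      Real.rpow_le_rpow_of_exponent_le (by linarith [n.cast_nonneg (α := ℝ)]) (by linarith)
    gcongr
  refine (norm_add_le _ _).trans ?_
  rw [norm_one]
  nlinarith [norm_nonneg s, mul_nonneg hT0 (norm_nonneg s)]

/-- The `n`-th Taylor coefficient of `hFun k` at the origin. -/
noncomputable def hCoeff (k n : ℕ) : ℝ :=
  (harmonic n : ℝ) - (harmonic (n / k) : ℝ) - Real.log k

lemma hCoeff_zero (k : ℕ) : hCoeff k 0 = -Real.log k := by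
  simp [hCoeff]

lemma hCoeff_succ_sub (k n : ℕ) :
    hCoeff k (n + 1) - hCoeff k n =
      1 / ((n : ℝ) + 1) - if k ∣ n + 1 then (k : ℝ) / ((n : ℝ) + 1) else 0 := by
  unfold hCoeff
  rw [harmonic_succ, Nat.succ_div]
  split_ifs with h
  · obtain ⟨j, hj⟩ := h
    have hk : k ≠ 0 := by rintro rfl; simp at hj
    have hk' : (k : ℝ) ≠ 0 := by exact_mod_cast hk
    have hj0 : j ≠ 0 := by rintro rfl; simp at hj
    have h1 : (n + 1) / k = j := by rw [hj]; exact Nat.mul_div_cancel_left _ (Nat.pos_of_ne_zero hk)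
    have h2 : n / k + 1 = j := by
      rw [← h1, Nat.succ_div, if_pos ⟨j, hj⟩]
    rw [harmonic_succ]
    have h3 : ((n / k : ℕ) : ℝ) + 1 = j := by exact_mod_cast h2
    have h4 : (n : ℝ) + 1 = k * j := by exact_mod_cast hj
    push_cast
    rw [h3, h4]
    have : (j : ℝ) ≠ 0 := by exact_mod_cast hj0
    field_simp
    ring
  · push_cast
    simp only [add_zero]
    ring

lemma harmonic_lt_eulerMascheroni_add_log (n : ℕ) :
    (harmonic n : ℝ) < Real.eulerMascheroniConstant + Real.log (n + 1) := by
  have := Real.eulerMascheroniSeq_lt_eulerMascheroniConstant n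
  unfold Real.eulerMascheroniSeq at this
  linarith

lemma eulerMascheroni_add_log_lt_harmonic {n : ℕ} (hn : n ≠ 0) :
    Real.eulerMascheroniConstant + Real.log n < (harmonic n : ℝ) := by
  have := Real.eulerMascheroniConstant_lt_eulerMascheroniSeq' n
  unfold Real.eulerMascheroniSeq' at this
  rw [if_neg hn] at this
  linarith

lemma abs_hCoeff_le {k : ℕ} (hk : 0 < k) (n : ℕ) :
    |hCoeff k n| ≤ 2 * (k : ℝ) ^ 2 / ((n : ℝ) + 1) := by
  have hk' : (1 : ℝ) ≤ k := by exact_mod_cast hk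
  rw [le_div_iff₀ (by positivity)]
  rcases Nat.eq_zero_or_pos (n / k) with h0 | hpos
  · have hnk : n < k := by
      rcases Nat.div_eq_zero_iff.1 h0 with h | h
      · omega
      · exact h
    have hH : (harmonic n : ℝ) ≤ n := by
      clear h0 hnk
      induction n with
      | zero => simp
      | succ n ih =>
        rw [harmonic_succ]
        push_cast
        have : ((n : ℝ) + 1)⁻¹ ≤ 1 := inv_le_one_of_one_le₀ (by linarith [n.cast_nonneg (α := ℝ)])
        linarith
    have hH0 : 0 ≤ (harmonic n : ℝ) := by
      unfold harmonic
      push_cast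
      positivity
    have hl : Real.log k ≤ k := (Real.log_le_sub_one_of_pos (by linarith)).trans (by linarith)
    have hl0 : 0 ≤ Real.log k := Real.log_nonneg hk'
    have hn1 : (n : ℝ) + 1 ≤ k := by exact_mod_cast hnk
    have h1 : |hCoeff k n| ≤ 2 * k := by
      unfold hCoeff
      rw [h0, abs_le]
      simp only [harmonic_zero, Rat.cast_zero, sub_zero]
      constructor <;> linarith
    calc |hCoeff k n| * ((n : ℝ) + 1) ≤ (2 * k) * k := by gcongr
      _ = _ := by ring
  · set m := n / k with hm
    have hm1 : (1 : ℝ) ≤ m := by exact_mod_cast hpos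
    have hmk : (m : ℝ) * k ≤ n := by exact_mod_cast Nat.div_mul_le_self n k
    have hmk2 : (n : ℝ) + 1 ≤ k * (m + 1) := by exact_mod_cast Nat.lt_mul_div_succ n hk
    have hn0 : n ≠ 0 := by
      rintro rfl
      simp [hm] at hpos
    have hn1 : (1 : ℝ) ≤ n := by exact_mod_cast Nat.one_le_iff_ne_zero.2 hn0
    have a1 := harmonic_lt_eulerMascheroni_add_log n
    have a2 := eulerMascheroni_add_log_lt_harmonic hn0
    have a3 := harmonic_lt_eulerMascheroni_add_log m
    have a4 := eulerMascheroni_add_log_lt_harmonic hpos.ne'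
    have b1 : Real.log ((n : ℝ) + 1) ≤ Real.log k + Real.log (m + 1) := by
      rw [← Real.log_mul (by positivity) (by positivity)]
      exact Real.log_le_log (by positivity) hmk2
    have b2 : Real.log m + Real.log k ≤ Real.log n := by
      rw [← Real.log_mul (by positivity) (by positivity)]
      exact Real.log_le_log (by positivity) hmk
    have b3 : Real.log (m + 1) - Real.log m ≤ 1 / m := by
      rw [← Real.log_div (by positivity) (by positivity)]
      refine (Real.log_le_sub_one_of_pos (by positivity)).trans (le_of_eq ?_)
      field_simp
      ring
    have h1 : |hCoeff k n| ≤ 1 / m := by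
      unfold hCoeff
      rw [abs_le]
      constructor <;> linarith
    calc |hCoeff k n| * ((n : ℝ) + 1) ≤ 1 / m * (k * (m + 1)) := by gcongr
      _ ≤ 1 / m * (k * (m + m)) := by gcongr
      _ = 2 * k := by field_simp; ring
      _ ≤ _ := by nlinarith

lemma hasSum_congr_of_eq {f g : ℕ → ℂ} {a : ℂ} (h : HasSum g a) (hfg : ∀ n, f n = g n) :
    HasSum f a := by rwa [funext hfg]

lemma hasSum_ite_dvd {k : ℕ} (hk : 0 < k) {F : ℕ → ℂ} {a : ℂ}
    (h : HasSum (fun j => F (k * (j + 1))) a) :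
    HasSum (fun n => if k ∣ n + 1 then F (n + 1) else 0) a := by
  have hinj : Function.Injective fun j : ℕ => k * (j + 1) - 1 := by
    intro i j hij
    have h1 : 0 < k * (i + 1) := by positivity
    have h2 : 0 < k * (j + 1) := by positivity
    simp only at hij
    have h3 : k * (i + 1) = k * (j + 1) := by omega
    have := Nat.eq_of_mul_eq_mul_left hk h3
    omega
  rw [← hinj.hasSum_iff]
  · convert h using 2 with j
    have h1 : 0 < k * (j + 1) := by positivity
    have h2 : k * (j + 1) - 1 + 1 = k * (j + 1) := by omega
    simp [h2]
  · intro n hn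
    rw [if_neg]
    rintro ⟨j, hj⟩
    apply hn
    have hj0 : j ≠ 0 := by rintro rfl; simp at hj
    refine ⟨j - 1, ?_⟩
    simp only
    rw [Nat.sub_add_cancel (Nat.one_le_iff_ne_zero.2 hj0)]
    omega

lemma norm_hCoeff_le {k : ℕ} (hk : 0 < k) (n : ℕ) :
    ‖(hCoeff k n : ℂ)‖ ≤ 2 * (k : ℝ) ^ 2 / ((n : ℝ) + 1) := by
  rw [norm_real]; exact abs_hCoeff_le hk n

lemma norm_hCoeff_le_const {k : ℕ} (hk : 0 < k) (n : ℕ) :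
    ‖(hCoeff k n : ℂ)‖ ≤ 2 * (k : ℝ) ^ 2 :=
  (norm_hCoeff_le hk n).trans
    (div_le_self (by positivity) (by linarith [n.cast_nonneg (α := ℝ)]))

lemma summable_norm_hCoeff_mul_pow {k : ℕ} (hk : 0 < k) {z : ℂ} (hz : ‖z‖ < 1) :
    Summable fun n => ‖(hCoeff k n : ℂ) * z ^ n‖ := by
  refine Summable.of_nonneg_of_le (fun _ => norm_nonneg _) (fun n => ?_)
    ((summable_geometric_of_lt_one (norm_nonneg z) hz).mul_left (2 * (k : ℝ) ^ 2))
  rw [norm_mul, norm_pow]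
  gcongr
  exact norm_hCoeff_le_const hk n

lemma hasSum_hCoeff_mul_pow {k : ℕ} (hk : 0 < k) {z : ℂ} (hz : ‖z‖ < 1) :
    HasSum (fun n => (hCoeff k n : ℂ) * z ^ n) (hFun k z) := by
  have h0 := (summable_norm_hCoeff_mul_pow hk hz).of_norm.hasSum
  set A := ∑' n, (hCoeff k n : ℂ) * z ^ n with hA
  have h1 : HasSum (fun n => (hCoeff k (n + 1) : ℂ) * z ^ (n + 1)) (A + Real.log k) := by
    have := (hasSum_nat_add_iff' 1).2 h0
    simpa [hCoeff_zero] using this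
  have h2 := h1.sub (h0.mul_left z)
  have hkz : ‖z ^ k‖ < 1 := by
    rw [norm_pow]; exact pow_lt_one₀ (norm_nonneg z) hz hk.ne'
  have l1 : HasSum (fun n : ℕ => z ^ (n + 1) / ((n : ℂ) + 1)) (-log (1 - z)) := by
    have := (hasSum_nat_add_iff' 1).2 (hasSum_taylorSeries_neg_log hz)
    simpa using this
  have l2 : HasSum (fun n : ℕ => (z ^ k) ^ (n + 1) / ((n : ℂ) + 1)) (-log (1 - z ^ k)) := by
    have := (hasSum_nat_add_iff' 1).2 (hasSum_taylorSeries_neg_log hkz)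
    simpa using this
  have hk0 : (k : ℂ) ≠ 0 := by exact_mod_cast hk.ne'
  have l3 := hasSum_ite_dvd hk (F := fun m => (k : ℂ) / m * z ^ m) (a := -log (1 - z ^ k)) (by
    convert l2 using 2 with j
    push_cast
    rw [← pow_mul]
    have : (j : ℂ) + 1 ≠ 0 := by exact_mod_cast Nat.succ_ne_zero j
    field_simp)
  have h3 : A + Real.log k - z * A = -log (1 - z) - -log (1 - z ^ k) := by
    refine h2.unique ?_
    convert l1.sub l3 using 2 with n
    have hn : (n : ℂ) + 1 ≠ 0 := by exact_mod_cast Nat.succ_ne_zero n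
    have h5 := congrArg (fun r : ℝ => (r : ℂ)) (hCoeff_succ_sub k n)
    simp only [ofReal_sub] at h5
    have h6 : (hCoeff k (n + 1) : ℂ) * z ^ (n + 1) - z * ((hCoeff k n : ℂ) * z ^ n)
        = ((hCoeff k (n + 1) : ℂ) - (hCoeff k n : ℂ)) * z ^ (n + 1) := by ring
    rw [h6, h5]
    split_ifs
    · push_cast
      ring
    · push_cast
      ring
  have hz1 : 1 - z ≠ 0 := by
    intro h
    rw [← sub_eq_zero.1 h] at hz
    simp at hz
  have : A = hFun k z := by
    unfold hFun gFun
    rw [eq_div_iff hz1]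
    linear_combination h3
  rwa [← this]

/-- The Dirichlet coefficients of the evaluation functional at `s`. -/
noncomputable def evalCoeff (s : ℂ) (n : ℕ) : ℂ := (n : ℂ) ^ (-s) - ((n : ℂ) + 1) ^ (-s)

lemma evalCoeff_zero {s : ℂ} (hs : s ≠ 0) : evalCoeff s 0 = -1 := by
  simp [evalCoeff, zero_cpow (neg_ne_zero.2 hs)]

lemma evalCoeff_succ (s : ℂ) (n : ℕ) :
    evalCoeff s (n + 1) = ((n : ℂ) + 1) ^ (-s) - ((n : ℂ) + 2) ^ (-s) := by
  simp only [evalCoeff]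
  push_cast
  rw [show (n : ℂ) + 1 + 1 = n + 2 by ring]

lemma norm_evalCoeff_succ_le {s : ℂ} (hs : -1 ≤ s.re) (n : ℕ) :
    ‖evalCoeff s (n + 1)‖ ≤ ‖s‖ * ((n : ℝ) + 1) ^ (-s.re - 1) := by
  have := norm_natCast_cpow_neg_sub_le (n := n + 1) (by omega) hs
  simpa [evalCoeff] using this

lemma norm_evalCoeff_mul_hCoeff_le {k : ℕ} (hk : 0 < k) {s : ℂ} (hs : -1 ≤ s.re) (n : ℕ) :
    ‖evalCoeff s (n + 1) * (hCoeff k (n + 1) : ℂ)‖ ≤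
      ‖s‖ * (2 * (k : ℝ) ^ 2) * ((n : ℝ) + 1) ^ (-s.re - 2) := by
  have h1 := norm_evalCoeff_succ_le hs n
  have h2 := norm_hCoeff_le hk (n + 1)
  push_cast at h2
  have hn : (0 : ℝ) < (n : ℝ) + 1 := by positivity
  have h3 : 2 * (k : ℝ) ^ 2 / ((n : ℝ) + 1 + 1) ≤ 2 * (k : ℝ) ^ 2 * ((n : ℝ) + 1) ^ (-1 : ℝ) := by
    rw [Real.rpow_neg_one, div_eq_mul_inv]
    gcongr
    linarith
  rw [norm_mul]
  calc _ ≤ ‖s‖ * ((n : ℝ) + 1) ^ (-s.re - 1) * (2 * (k : ℝ) ^ 2 * ((n : ℝ) + 1) ^ (-1 : ℝ)) := by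
        gcongr
        exact h2.trans h3
    _ = ‖s‖ * (2 * (k : ℝ) ^ 2) * (((n : ℝ) + 1) ^ (-s.re - 1) * ((n : ℝ) + 1) ^ (-1 : ℝ)) := by
        ring
    _ = _ := by rw [← Real.rpow_add hn]; ring_nf

lemma summable_evalCoeff_mul_hCoeff {k : ℕ} (hk : 0 < k) {s : ℂ} (hs : -1 < s.re) :
    Summable fun n => evalCoeff s (n + 1) * (hCoeff k (n + 1) : ℂ) :=
  Summable.of_norm_bounded ((summable_nat_add_one_rpow (by linarith)).mul_left _)
    (norm_evalCoeff_mul_hCoeff_le hk hs.le)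

lemma tsum_evalCoeff_of_pos {k : ℕ} (hk : 0 < k) {s : ℂ} (hs : 0 < s.re) :
    ∑' n, evalCoeff s (n + 1) * (hCoeff k (n + 1) : ℂ) =
      riemannZeta (s + 1) * (1 - (k : ℂ) ^ (-s)) - Real.log k := by
  have hk0 : (k : ℂ) ≠ 0 := by exact_mod_cast hk.ne'
  have hz := hasSum_zeta (s := s + 1) (by simpa using hs)
  have hd := hasSum_ite_dvd hk (F := fun m => (k : ℂ) * (m : ℂ) ^ (-(s + 1)))
    (a := (k : ℂ) ^ (-s) * riemannZeta (s + 1)) (by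
      refine hasSum_congr_of_eq (hz.mul_left ((k : ℂ) ^ (-s))) fun j => ?_
      have := natCast_mul_natCast_cpow k (j + 1) (-(s + 1))
      push_cast at this ⊢
      rw [this, ← mul_assoc]
      congr 1
      rw [show -(s + 1) = -s - 1 by ring, cpow_sub _ _ hk0, cpow_one]
      field_simp)
  have hS := (hz.sub hd).tendsto_sum_nat
  have hD := (summable_evalCoeff_mul_hCoeff hk (s := s) (by linarith)).hasSum.tendsto_sum_nat
  have hb : Filter.Tendsto (fun N : ℕ => ((N : ℂ) + 1) ^ (-s) * (hCoeff k N : ℂ))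
      Filter.atTop (nhds 0) := by
    rw [tendsto_zero_iff_norm_tendsto_zero]
    have := ((tendsto_natCast_add_one_cpow_neg hs).norm).mul_const (2 * (k : ℝ) ^ 2)
    rw [norm_zero, zero_mul] at this
    refine squeeze_zero (fun _ => norm_nonneg _) (fun N => ?_) this
    rw [norm_mul]
    gcongr
    exact norm_hCoeff_le_const hk N
  have hid : ∀ N : ℕ, ∑ n ∈ Finset.range N, evalCoeff s (n + 1) * (hCoeff k (n + 1) : ℂ) =
      ∑ n ∈ Finset.range N, (((n : ℂ) + 1) ^ (-(s + 1)) -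
        if k ∣ n + 1 then (k : ℂ) * ((n + 1 : ℕ) : ℂ) ^ (-(s + 1)) else 0)
        - Real.log k - ((N : ℂ) + 1) ^ (-s) * (hCoeff k N : ℂ) := by
    intro N
    induction N with
    | zero => simp [hCoeff_zero]
    | succ N ih =>
      rw [Finset.sum_range_succ, Finset.sum_range_succ, ih, evalCoeff_succ]
      have hn : (N : ℂ) + 1 ≠ 0 := by exact_mod_cast Nat.succ_ne_zero N
      have h5 := congrArg (fun r : ℝ => (r : ℂ)) (hCoeff_succ_sub k N)
      simp only [ofReal_sub] at h5
      have h7 : ((N : ℂ) + 1) ^ (-(s + 1)) = ((N : ℂ) + 1) ^ (-s) / ((N : ℂ) + 1) := by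
        rw [show -(s + 1) = -s - 1 by ring, cpow_sub _ _ hn, cpow_one]
      have h6 : ((N : ℂ) + 1) ^ (-s) * ((hCoeff k (N + 1) : ℂ) - (hCoeff k N : ℂ)) =
          ((N : ℂ) + 1) ^ (-(s + 1)) -
            if k ∣ N + 1 then (k : ℂ) * ((N + 1 : ℕ) : ℂ) ^ (-(s + 1)) else 0 := by
        rw [h5]
        push_cast
        rw [h7]
        split_ifs
        · push_cast
          ring
        · push_cast
          ring
      rw [← h6]
      push_cast
      rw [show (N : ℂ) + 1 + 1 = N + 2 by ring]
      ring
  simp_rw [hid] at hD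
  rw [tendsto_nhds_unique hD ((hS.sub_const _).sub hb)]
  ring

lemma tsum_evalCoeff {k : ℕ} (hk : 0 < k) {s : ℂ} (hs : -1 < s.re) :
    s * (∑' n, evalCoeff s (n + 1) * (hCoeff k (n + 1) : ℂ) + Real.log k) =
      riemannZeta₁ (s + 1) * (1 - (k : ℂ) ^ (-s)) := by
  set a := (s.re - 1) / 2 with ha
  set R := ‖s‖ + max a 0 + 1 + |a| + |0| + 1
  have ha1 : -1 < a := by simp only [ha]; linarith
  have hk0 : (k : ℂ) ≠ 0 := by exact_mod_cast hk.ne'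
  refine eqOn_cutHalfPlane (a := a) (R := R) (b := 0)
    (f := fun s => s * (∑' n, evalCoeff s (n + 1) * (hCoeff k (n + 1) : ℂ) + Real.log k))
    (g := fun s => riemannZeta₁ (s + 1) * (1 - (k : ℂ) ^ (-s))) ?_ ?_ ?_ ?_ ?_
  · refine differentiableOn_id.mul (DifferentiableOn.add_const _
      (differentiableOn_tsum_of_summable_norm
      (u := fun n : ℕ => R * (2 * (k : ℝ) ^ 2) * ((n : ℝ) + 1) ^ (-a - 2))
      ((summable_nat_add_one_rpow (by linarith)).mul_left _) (fun n => ?_)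
      (isOpen_cutHalfPlane _ _) (fun n w hw => ?_)))
    · have h1 := differentiable_natCast_add_one_cpow n 0 (-1)
      have h3 := differentiable_natCast_add_one_cpow (n + 1) 0 (-1)
      refine Differentiable.differentiableOn ?_
      have h4 : (fun w => evalCoeff w (n + 1) * (hCoeff k (n + 1) : ℂ)) =
          fun w => (((n : ℂ) + 1) ^ (0 + -1 * w) -
          (((n + 1 : ℕ) : ℂ) + 1) ^ (0 + -1 * w)) * (hCoeff k (n + 1) : ℂ) := by
        ext w
        simp [evalCoeff]
      rw [h4]
      fun_prop
    · have hw1 : a < w.re := hw.1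
      have hw2 : ‖w‖ < R := by simpa using hw.2
      refine (norm_evalCoeff_mul_hCoeff_le hk (by linarith) n).trans ?_
      have h4 : ((n : ℝ) + 1) ^ (-w.re - 2) ≤ ((n : ℝ) + 1) ^ (-a - 2) :=
        Real.rpow_le_rpow_of_exponent_le (by linarith [n.cast_nonneg (α := ℝ)]) (by linarith)
      gcongr
  · refine Differentiable.differentiableOn ?_
    refine Differentiable.mul (differentiable_riemannZeta₁.comp (by fun_prop)) ?_
    refine (differentiable_const _).sub fun w => ?_
    exact DifferentiableAt.const_cpow (by fun_prop) (Or.inl hk0)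
  · have := norm_nonneg s
    simp only [R]
    linarith
  · intro w hw
    have hw0 : w ≠ 0 := by rintro rfl; simp at hw
    rw [tsum_evalCoeff_of_pos hk hw, riemannZeta_eq_inv_sub_mul (by simpa using hw0)]
    rw [add_sub_cancel_right]
    field_simp
    ring
  · refine ⟨?_, ?_⟩
    · simp only [Set.mem_ofPred_eq, ha]; linarith
    · simp only [mem_ball_zero_iff, R]
      linarith [abs_nonneg a, abs_nonneg (0 : ℝ), le_max_right a 0]

/-- Evaluating the Dirichlet-type functional on the coefficients of `hFun k`. -/
lemma hasSum_evalCoeff {k : ℕ} (hk : 0 < k) {s : ℂ} (hs : -1 < s.re) (hs0 : s ≠ 0) :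
    HasSum (fun n => evalCoeff s n * (hCoeff k n : ℂ))
      (riemannZeta (s + 1) * (1 - (k : ℂ) ^ (-s))) := by
  have h1 := tsum_evalCoeff hk hs
  have h2 := (summable_evalCoeff_mul_hCoeff hk hs).hasSum
  rw [riemannZeta_eq_inv_sub_mul (by simpa using hs0), add_sub_cancel_right, mul_assoc, ← h1,
    inv_mul_cancel_left₀ hs0]
  rw [← hasSum_nat_add_iff' 1]
  simpa [evalCoeff_zero hs0, hCoeff_zero] using h2

lemma mem_of_tendsto_ae_of_dominated {α : Type*} [MeasurableSpace α] {μ : Measure α}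
    {K : Submodule ℂ (Lp ℂ 2 μ)} (hK : IsClosed (K : Set (Lp ℂ 2 μ)))
    {u : ℕ → Lp ℂ 2 μ} {v : Lp ℂ 2 μ} {G : α → ℝ} (hu : ∀ n, u n ∈ K) (hG : MemLp G 2 μ)
    (hle : ∀ n, ∀ᵐ t ∂μ, ‖u n t‖ ≤ G t)
    (hlim : ∀ᵐ t ∂μ, Filter.Tendsto (fun n => u n t) Filter.atTop (nhds (v t))) : v ∈ K := by
  have : CompleteSpace K := hK.completeSpace_coe
  rw [← K.orthogonal_orthogonal, Submodule.mem_orthogonal]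
  intro w hw
  rw [Submodule.mem_orthogonal'] at hw
  have h0 : ∀ n, inner ℂ w (u n) = 0 := fun n => hw _ (hu n)
  simp_rw [L2.inner_def] at h0 ⊢
  have h1 := tendsto_integral_of_dominated_convergence (μ := μ)
    (F := fun n t => inner ℂ (w t) (u n t)) (f := fun t => inner ℂ (w t) (v t))
    (fun t => ‖w t‖ * G t) (fun n => ((Lp.aestronglyMeasurable w).inner
      (Lp.aestronglyMeasurable (u n))))
    ((Lp.memLp w).norm.integrable_mul hG) (fun n => ?_) ?_
  · simp_rw [h0] at h1
    exact (tendsto_nhds_unique tendsto_const_nhds h1).symm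
  · filter_upwards [hle n] with t ht
    exact (norm_inner_le_norm _ _).trans (by gcongr)
  · filter_upwards [hlim] with t ht
    exact tendsto_const_nhds.inner ht

lemma ae_eq_of_tendsto_of_tendsto_ae {α : Type*} [MeasurableSpace α] {μ : Measure α}
    {u : ℕ → Lp ℂ 2 μ} {v : Lp ℂ 2 μ} {f : α → ℂ}
    (hu : Filter.Tendsto u Filter.atTop (nhds v))
    (hlim : ∀ᵐ t ∂μ, Filter.Tendsto (fun n => u n t) Filter.atTop (nhds (f t))) :
    v =ᵐ[μ] f := by
  obtain ⟨φ, hφ, h⟩ := (tendstoInMeasure_of_tendsto_Lp hu).exists_seq_tendsto_ae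
  filter_upwards [h, hlim] with t h1 h2
  exact tendsto_nhds_unique h1 (h2.comp hφ.tendsto_atTop)

/-- The space of square summable complex sequences. -/
abbrev SeqL2 : Type := lp (fun _ : ℕ => ℂ) 2

/-- The isometric embedding of `SeqL2` attached to an orthonormal sequence. -/
noncomputable def onIsometry {E : Type*} [NormedAddCommGroup E] [InnerProductSpace ℂ E]
    [CompleteSpace E] {b : ℕ → E} (hb : Orthonormal ℂ b) : SeqL2 →ₗᵢ[ℂ] E :=
  hb.orthogonalFamily.linearIsometry

lemma hasSum_onIsometry {E : Type*} [NormedAddCommGroup E] [InnerProductSpace ℂ E]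
    [CompleteSpace E] {b : ℕ → E} (hb : Orthonormal ℂ b) (x : SeqL2) :
    HasSum (fun n => x n • b n) (onIsometry hb x) := by
  have := hb.orthogonalFamily.hasSum_linearIsometry x
  simpa [onIsometry] using this

lemma onIsometry_single {E : Type*} [NormedAddCommGroup E] [InnerProductSpace ℂ E]
    [CompleteSpace E] {b : ℕ → E} (hb : Orthonormal ℂ b) (n : ℕ) :
    onIsometry hb (lp.single 2 n (1 : ℂ)) = b n := by
  simp [onIsometry]

lemma onIsometry_ae_eq {α : Type*} [MeasurableSpace α] {μ : Measure α} {b : ℕ → Lp ℂ 2 μ}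
    (hb : Orthonormal ℂ b) {β : ℕ → α → ℂ} (hβ : ∀ n, b n =ᵐ[μ] β n) {x : SeqL2} {f : α → ℂ}
    (h : ∀ᵐ t ∂μ, HasSum (fun n => x n * β n t) (f t)) : onIsometry hb x =ᵐ[μ] f := by
  refine ae_eq_of_tendsto_of_tendsto_ae (hasSum_onIsometry hb x).tendsto_sum_nat ?_
  have h1 : ∀ N : ℕ, ((∑ n ∈ Finset.range N, x n • b n : Lp ℂ 2 μ) : α → ℂ) =ᵐ[μ]
      fun t => ∑ n ∈ Finset.range N, x n * β n t := by
    intro N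
    induction N with
    | zero =>
      simp only [Finset.range_zero, Finset.sum_empty]
      exact Lp.coeFn_zero _ _ _
    | succ N ih =>
      simp_rw [Finset.sum_range_succ]
      refine (Lp.coeFn_add _ _).trans ?_
      filter_upwards [ih, Lp.coeFn_smul (x N) (b N), hβ N] with t h2 h3 h4
      rw [Pi.add_apply, h2, h3, Pi.smul_apply, h4, smul_eq_mul]
  filter_upwards [h, ae_all_iff.2 h1] with t h2 h3
  simp_rw [h3]
  exact h2.tendsto_sum_nat

lemma memlp_two_iff {x : ℕ → ℂ} : Memℓp x 2 ↔ Summable fun n => ‖x n‖ ^ 2 := by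
  rw [memℓp_gen_iff (by norm_num)]
  norm_num

/-- A square summable sequence as an element of `SeqL2`. -/
noncomputable def mkSeq (x : ℕ → ℂ) (hx : Summable fun n => ‖x n‖ ^ 2) : SeqL2 :=
  ⟨x, memlp_two_iff.2 hx⟩

lemma mkSeq_apply (x : ℕ → ℂ) (hx : Summable fun n => ‖x n‖ ^ 2) (n : ℕ) : mkSeq x hx n = x n :=
  rfl

/-- The coefficient sequence of `hFun k` as an element of `SeqL2` (junk value `0` for `k = 0`). -/
noncomputable def hSeq (k : ℕ) : SeqL2 :=
  if hk : 0 < k then mkSeq (fun n => (hCoeff k n : ℂ)) (by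
    refine Summable.of_nonneg_of_le (fun _ => by positivity) (fun n => ?_)
      ((summable_nat_add_one_rpow (p := -2) (by norm_num)).mul_left ((2 * (k : ℝ) ^ 2) ^ 2))
    have := norm_hCoeff_le hk n
    calc _ ≤ (2 * (k : ℝ) ^ 2 / ((n : ℝ) + 1)) ^ 2 := by gcongr
      _ = _ := by
        rw [Real.rpow_neg (by positivity)]
        norm_cast
        rw [div_pow]
        push_cast
        ring)
  else 0

lemma hSeq_apply {k : ℕ} (hk : 0 < k) (n : ℕ) : hSeq k n = (hCoeff k n : ℂ) := by
  rw [hSeq, dif_pos hk, mkSeq_apply]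

/-- The sequence `n ↦ r ^ n * x n`. -/
noncomputable def dampSeq (r : ℝ) (hr : |r| ≤ 1) (x : SeqL2) : SeqL2 :=
  mkSeq (fun n => (r : ℂ) ^ n * x n) (by
    have hx := memlp_two_iff.1 (lp.memℓp x)
    refine Summable.of_nonneg_of_le (fun _ => by positivity) (fun n => ?_) hx
    rw [norm_mul, norm_pow, norm_real, Real.norm_eq_abs]
    gcongr
    exact mul_le_of_le_one_left (norm_nonneg _) (pow_le_one₀ (abs_nonneg r) hr))

lemma dampSeq_apply (r : ℝ) (hr : |r| ≤ 1) (x : SeqL2) (n : ℕ) :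
    dampSeq r hr x n = (r : ℂ) ^ n * x n := rfl

lemma seqL2_norm_sq (x : SeqL2) : ‖x‖ ^ 2 = ∑' n, ‖x n‖ ^ 2 := by
  have := lp.norm_rpow_eq_tsum (p := 2) (by norm_num) x
  norm_num at this
  exact_mod_cast this

lemma tendsto_dampSeq (x : SeqL2) {r : ℕ → ℝ} (hr : ∀ n, |r n| ≤ 1)
    (hlim : Filter.Tendsto r Filter.atTop (nhds 1)) :
    Filter.Tendsto (fun m => dampSeq (r m) (hr m) x) Filter.atTop (nhds x) := by
  rw [tendsto_iff_norm_sub_tendsto_zero]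
  have hx := memlp_two_iff.1 (lp.memℓp x)
  have h1 : Filter.Tendsto (fun m => ∑' n, ‖((r m : ℂ) ^ n - 1) * x n‖ ^ 2) Filter.atTop
      (nhds (∑' n : ℕ, (0 : ℝ))) := by
    refine tendsto_tsum_of_dominated_convergence (bound := fun n => 4 * ‖x n‖ ^ 2)
      (hx.mul_left 4) (fun n => ?_) (Filter.Eventually.of_forall fun m n => ?_)
    · have h2 : Filter.Tendsto (fun m => (r m : ℂ)) Filter.atTop (nhds ((1 : ℝ) : ℂ)) :=
        (continuous_ofReal.tendsto 1).comp hlim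
      have h3 := ((((h2.pow n).sub_const 1).mul_const (x n)).norm).pow 2
      simpa using h3
    · rw [Real.norm_eq_abs, abs_of_nonneg (by positivity), norm_mul, mul_pow]
      have : ‖(r m : ℂ) ^ n - 1‖ ≤ 2 := by
        refine (norm_sub_le _ _).trans ?_
        rw [norm_pow, norm_real, norm_one, Real.norm_eq_abs]
        linarith [pow_le_one₀ (n := n) (abs_nonneg (r m)) (hr m)]
      gcongr
      nlinarith [norm_nonneg ((r m : ℂ) ^ n - 1)]
  have h2 : ∀ m, ‖dampSeq (r m) (hr m) x - x‖ ^ 2 = ∑' n, ‖((r m : ℂ) ^ n - 1) * x n‖ ^ 2 := by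
    intro m
    rw [seqL2_norm_sq]
    refine tsum_congr fun n => ?_
    congr 2
    rw [lp.coeFn_sub, Pi.sub_apply, dampSeq_apply]
    ring
  simp_rw [← h2, tsum_zero] at h1
  have := h1.sqrt
  simpa using this

lemma measurable_circleParam : Measurable fun θ : ℝ => Complex.exp (θ * Complex.I) := by
  fun_prop

instance isProbabilityMeasure_mCirc : IsProbabilityMeasure mCirc := by
  constructor
  rw [mCirc, Measure.smul_apply, Measure.map_apply measurable_circleParam MeasurableSet.univ]
  simp only [Set.preimage_univ, Measure.restrict_apply_univ, Real.volume_Ioc, sub_zero,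
    smul_eq_mul]
  refine ENNReal.inv_mul_cancel ?_ ENNReal.ofReal_ne_top
  simp [Real.pi_pos]

lemma integral_mCirc {f : ℂ → ℂ} (hf : AEStronglyMeasurable f mCirc) :
    ∫ ω, f ω ∂mCirc = (2 * Real.pi)⁻¹ * ∫ θ in (0 : ℝ)..2 * Real.pi, f (exp (θ * I)) := by
  have hpos : (0 : ℝ) ≤ 2 * Real.pi := by positivity
  have hf' : AEStronglyMeasurable f (Measure.map (fun θ : ℝ => Complex.exp (θ * Complex.I))
      (volume.restrict (Set.Ioc 0 (2 * Real.pi)))) := by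
    exact hf.mono_ac (Measure.absolutelyContinuous_smul
      (ENNReal.inv_ne_zero.2 ENNReal.ofReal_ne_top))
  rw [mCirc, integral_smul_measure, integral_map measurable_circleParam.aemeasurable hf',
    intervalIntegral.integral_of_le hpos, ENNReal.toReal_inv, ENNReal.toReal_ofReal hpos,
    real_smul]

lemma ae_mCirc_iff_of_measurableSet {p : ℂ → Prop} (hp : MeasurableSet {ω | p ω})
    (h : ∀ᵐ θ : ℝ, p (exp (θ * I))) : ∀ᵐ ω ∂mCirc, p ω := by
  rw [mCirc]
  refine Measure.ae_smul_measure ?_ _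
  rw [ae_map_iff measurable_circleParam.aemeasurable hp]
  exact ae_restrict_of_ae h

lemma ae_mCirc_norm_eq_one : ∀ᵐ ω ∂mCirc, ‖ω‖ = 1 :=
  ae_mCirc_iff_of_measurableSet (measurableSet_eq_fun measurable_norm measurable_const)
    (Filter.Eventually.of_forall fun θ => norm_exp_ofReal_mul_I θ)

lemma ae_mCirc_ne (c : ℂ) : ∀ᵐ ω ∂mCirc, ω ≠ c := by
  refine ae_mCirc_iff_of_measurableSet (measurableSet_singleton c).compl ?_
  rw [ae_iff]
  simp only [ne_eq, not_not]
  refine Set.Countable.measure_zero ?_ _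
  by_cases h : ∃ θ₀ : ℝ, exp (θ₀ * I) = c
  · obtain ⟨θ₀, rfl⟩ := h
    refine (Set.countable_range fun n : ℤ => θ₀ + n * (2 * Real.pi)).mono fun θ hθ => ?_
    obtain ⟨n, hn⟩ := exp_eq_exp_iff_exists_int.1 hθ
    refine ⟨n, ?_⟩
    have h2 : (θ : ℂ) * I = ((θ₀ + n * (2 * Real.pi) : ℝ) : ℂ) * I := by
      rw [hn]; push_cast; ring
    exact_mod_cast (mul_right_cancel₀ I_ne_zero h2).symm
  · push Not at h
    convert Set.countable_empty
    ext θ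
    simp [h θ]

lemma ae_mCirc_pow_ne_one {k : ℕ} (hk : 0 < k) : ∀ᵐ ω ∂mCirc, ω ^ k ≠ 1 := by
  have hfin : {ω : ℂ | ω ^ k = 1}.Finite := by
    refine (Polynomial.nthRoots k (1 : ℂ)).toFinset.finite_toSet.subset fun ω hω => ?_
    simpa [Polynomial.mem_nthRoots hk] using hω
  have := (ae_ball_iff hfin.countable (p := fun ω c _ => ω ≠ c)).2 fun c _ => ae_mCirc_ne c
  filter_upwards [this] with ω h h1
  exact h ω h1 rfl

lemma memLp_pow_mCirc (n : ℕ) : MemLp (fun ω : ℂ => ω ^ n) 2 mCirc := by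
  refine MemLp.of_bound (by fun_prop) 1 ?_
  filter_upwards [ae_mCirc_norm_eq_one] with ω h
  simp [h]

/-- The monomials as elements of `L²(mCirc)`. -/
noncomputable def monomLp (n : ℕ) : Lp ℂ 2 mCirc := (memLp_pow_mCirc n).toLp

lemma monomLp_ae (n : ℕ) : monomLp n =ᵐ[mCirc] fun ω : ℂ => ω ^ n := MemLp.coeFn_toLp _

lemma orthonormal_monomLp : Orthonormal ℂ monomLp := by
  rw [orthonormal_iff_ite]
  intro m n
  rw [L2.inner_def]
  have h1 : ∫ ω, inner ℂ (monomLp m ω) (monomLp n ω) ∂mCirc =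
      ∫ ω : ℂ, ω ^ n * (starRingEnd ℂ) (ω ^ m) ∂mCirc := by
    refine integral_congr_ae ?_
    filter_upwards [monomLp_ae m, monomLp_ae n] with ω h1 h2
    rw [h1, h2, RCLike.inner_apply]
  rw [h1, integral_mCirc (by fun_prop)]
  have h2 : ∀ θ : ℝ, exp (θ * I) ^ n * (starRingEnd ℂ) (exp (θ * I) ^ m) =
      exp ((((n : ℂ) - m) * I) * θ) := by
    intro θ
    rw [map_pow, ← exp_conj, ← exp_nat_mul, ← exp_nat_mul, ← exp_add]
    congr 1
    simp
    ring
  simp_rw [h2]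
  split_ifs with h
  · subst h
    simp
    field_simp
  · have hc : ((n : ℂ) - m) * I ≠ 0 := by
      refine mul_ne_zero (sub_ne_zero.2 ?_) I_ne_zero
      exact_mod_cast Ne.symm h
    rw [integral_exp_mul_complex hc]
    have h3 : exp (((n : ℂ) - m) * I * ((2 * Real.pi : ℝ) : ℂ)) = 1 := by
      rw [exp_eq_one_iff]
      exact ⟨(n : ℤ) - m, by push_cast; ring⟩
    rw [h3]
    simp

/-- The isometry sending a sequence to the corresponding power series on the circle. -/
noncomputable def circIso : SeqL2 →ₗᵢ[ℂ] Lp ℂ 2 mCirc := onIsometry orthonormal_monomLp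

lemma one_sub_mem_slitPlane {z : ℂ} (hz : ‖z‖ ≤ 1) (hz1 : z ≠ 1) : 1 - z ∈ slitPlane := by
  by_cases h : z.re < 1
  · left
    simpa using h
  · right
    intro him
    have him' : z.im = 0 := by simpa using him
    have hre : z.re = 1 := le_antisymm ((re_le_norm z).trans hz) (not_lt.1 h)
    exact hz1 (Complex.ext hre him')

lemma continuousAt_gFun {k : ℕ} {z : ℂ} (hz : ‖z‖ ≤ 1) (hz1 : z ≠ 1) (hzk : z ^ k ≠ 1) :
    ContinuousAt (gFun k) z := by
  have h1 := one_sub_mem_slitPlane hz hz1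
  have h2 : 1 - z ^ k ∈ slitPlane :=
    one_sub_mem_slitPlane (by rw [norm_pow]; exact pow_le_one₀ (norm_nonneg z) hz) hzk
  have h3 : ContinuousAt (fun z : ℂ => 1 - z ^ k) z := by fun_prop
  have h4 : ContinuousAt (fun z : ℂ => 1 - z) z := by fun_prop
  exact ((h3.clog h2).sub (h4.clog h1)).sub continuousAt_const

lemma continuousAt_hFun {k : ℕ} {z : ℂ} (hz : ‖z‖ ≤ 1) (hz1 : z ≠ 1) (hzk : z ^ k ≠ 1) :
    ContinuousAt (hFun k) z := by
  unfold hFun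
  exact (continuousAt_gFun hz hz1 hzk).div (by fun_prop) (sub_ne_zero.2 hz1.symm)

/-- A sequence of radii increasing to `1`. -/
noncomputable def radius (m : ℕ) : ℝ := 1 - 1 / ((m : ℝ) + 1)

lemma radius_nonneg (m : ℕ) : 0 ≤ radius m := by
  unfold radius
  rw [sub_nonneg, div_le_one (by positivity)]
  linarith [m.cast_nonneg (α := ℝ)]

lemma radius_lt_one (m : ℕ) : radius m < 1 := by
  unfold radius
  have : 0 < 1 / ((m : ℝ) + 1) := by positivity
  linarith

lemma abs_radius_le (m : ℕ) : |radius m| ≤ 1 := by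
  rw [abs_of_nonneg (radius_nonneg m)]; exact (radius_lt_one m).le

lemma tendsto_radius : Filter.Tendsto radius Filter.atTop (nhds 1) := by
  have := (tendsto_one_div_add_atTop_nhds_zero_nat (𝕜 := ℝ)).const_sub 1
  rw [sub_zero] at this
  exact this

lemma tendsto_radius_mul (ω : ℂ) :
    Filter.Tendsto (fun m => (radius m : ℂ) * ω) Filter.atTop (nhds ω) := by
  have h2 : Filter.Tendsto (fun m => (radius m : ℂ)) Filter.atTop (nhds ((1 : ℝ) : ℂ)) :=
    (continuous_ofReal.tendsto 1).comp tendsto_radius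
  simpa using h2.mul_const ω

lemma circIso_hSeq {k : ℕ} (hk : 0 < k) : circIso (hSeq k) =ᵐ[mCirc] hFun k := by
  have h1 := (circIso.continuous.tendsto _).comp
    (tendsto_dampSeq (hSeq k) abs_radius_le tendsto_radius)
  refine ae_eq_of_tendsto_of_tendsto_ae h1 ?_
  have h2 : ∀ m : ℕ, circIso (dampSeq (radius m) (abs_radius_le m) (hSeq k)) =ᵐ[mCirc]
      fun ω => hFun k (radius m * ω) := by
    intro m
    refine onIsometry_ae_eq _ monomLp_ae ?_
    filter_upwards [ae_mCirc_norm_eq_one] with ω hω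
    have hz : ‖(radius m : ℂ) * ω‖ < 1 := by
      rw [norm_mul, hω, mul_one, norm_real, Real.norm_eq_abs, abs_of_nonneg (radius_nonneg m)]
      exact radius_lt_one m
    refine hasSum_congr_of_eq (hasSum_hCoeff_mul_pow hk hz) fun n => ?_
    rw [dampSeq_apply, hSeq_apply hk]
    ring
  filter_upwards [ae_all_iff.2 h2, ae_mCirc_norm_eq_one, ae_mCirc_ne 1, ae_mCirc_pow_ne_one hk]
    with ω h3 h4 h5 h6
  simp_rw [Function.comp_apply, h3]
  exact ((continuousAt_hFun h4.le h5 h6).tendsto).comp (tendsto_radius_mul ω)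

/-- `g` is the product of `f` with the coordinate function. -/
def IsShift (f g : Lp ℂ 2 mCirc) : Prop := (g : ℂ → ℂ) =ᵐ[mCirc] fun ω => ω * f ω

lemma exists_isShift (f : Lp ℂ 2 mCirc) : ∃ g, IsShift f g := by
  have h : MemLp (fun ω => ω * f ω) 2 mCirc := by
    refine (Lp.memLp f).of_le (aestronglyMeasurable_id.mul (Lp.aestronglyMeasurable f)) ?_
    filter_upwards [ae_mCirc_norm_eq_one] with ω hω
    rw [norm_mul, hω, one_mul]
  exact ⟨h.toLp, h.coeFn_toLp⟩

lemma isShift_unique {f g g' : Lp ℂ 2 mCirc} (h : IsShift f g) (h' : IsShift f g') : g = g' :=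
  Lp.ext (h.trans h'.symm)

lemma orthonormal_monomLp_succ : Orthonormal ℂ fun n => monomLp (n + 1) :=
  orthonormal_monomLp.comp _ (add_left_injective 1)

lemma isShift_circIso (x : SeqL2) :
    IsShift (circIso x) (onIsometry orthonormal_monomLp_succ x) := by
  have h1 := (hasSum_onIsometry orthonormal_monomLp x).tendsto_sum_nat
  have h2 := (hasSum_onIsometry orthonormal_monomLp_succ x).tendsto_sum_nat
  obtain ⟨φ, hφ, h3⟩ := (tendstoInMeasure_of_tendsto_Lp h1).exists_seq_tendsto_ae
  refine ae_eq_of_tendsto_of_tendsto_ae (h2.comp hφ.tendsto_atTop) ?_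
  have h4 : ∀ N : ℕ, ((∑ n ∈ Finset.range N, x n • monomLp (n + 1) : Lp ℂ 2 mCirc) : ℂ → ℂ)
      =ᵐ[mCirc] fun ω => ω * (∑ n ∈ Finset.range N, x n • monomLp n : Lp ℂ 2 mCirc) ω := by
    intro N
    induction N with
    | zero =>
      simp only [Finset.range_zero, Finset.sum_empty]
      filter_upwards [Lp.coeFn_zero ℂ 2 mCirc] with ω h
      rw [h]
      simp
    | succ N ih =>
      simp_rw [Finset.sum_range_succ]
      refine (Lp.coeFn_add _ _).trans ?_
      filter_upwards [ih, Lp.coeFn_smul (x N) (monomLp N), Lp.coeFn_smul (x N) (monomLp (N + 1)),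
        monomLp_ae N, monomLp_ae (N + 1), Lp.coeFn_add (∑ n ∈ Finset.range N, x n • monomLp n)
          (x N • monomLp N)] with ω h2 h3 h4 h5 h6 h7
      rw [Pi.add_apply, h2, h7, h4, Pi.smul_apply, h6, Pi.add_apply, h3, Pi.smul_apply, h5,
        smul_eq_mul, smul_eq_mul]
      ring
  filter_upwards [h3, ae_all_iff.2 h4] with ω h5 h6
  simp_rw [Function.comp_apply, h6]
  exact h5.const_mul ω

lemma isClosed_range_circIso : IsClosed (Set.range circIso) :=
  circIso.isometry.isClosedEmbedding.isClosed_range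

lemma mem_range_circIso_of_isShift {f g : Lp ℂ 2 mCirc} (hf : f ∈ Set.range circIso)
    (h : IsShift f g) : g ∈ Set.range circIso := by
  obtain ⟨x, rfl⟩ := hf
  rw [isShift_unique h (isShift_circIso x)]
  refine isClosed_range_circIso.mem_of_tendsto
    (hasSum_onIsometry orthonormal_monomLp_succ x).tendsto_sum_nat
    (Filter.Eventually.of_forall fun N => ?_)
  refine ⟨∑ n ∈ Finset.range N, x n • lp.single 2 (n + 1) (1 : ℂ), ?_⟩
  rw [map_sum]
  refine Finset.sum_congr rfl fun n _ => ?_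
  rw [map_smul]
  congr 1
  exact onIsometry_single _ _

section ShiftInvariant

variable {K : Submodule ℂ (Lp ℂ 2 mCirc)}

lemma exists_mem_ae_eq_pow_mul (hS : ∀ f ∈ K, ∀ g, IsShift f g → g ∈ K) {f : Lp ℂ 2 mCirc}
    (hf : f ∈ K) (n : ℕ) : ∃ u ∈ K, u =ᵐ[mCirc] fun ω => ω ^ n * f ω := by
  induction n with
  | zero => exact ⟨f, hf, by simp⟩
  | succ n ih =>
    obtain ⟨u, hu, h⟩ := ih
    obtain ⟨g, hg⟩ := exists_isShift u
    refine ⟨g, hS u hu g hg, hg.trans ?_⟩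
    filter_upwards [h] with ω h
    rw [h]
    ring

lemma exists_mem_ae_eq_tsum_mul (hK : IsClosed (K : Set (Lp ℂ 2 mCirc)))
    (hS : ∀ f ∈ K, ∀ g, IsShift f g → g ∈ K) {f : Lp ℂ 2 mCirc} (hf : f ∈ K) {c : ℕ → ℂ}
    (hc : Summable fun n => ‖c n‖) :
    ∃ u ∈ K, u =ᵐ[mCirc] fun ω => (∑' n, c n * ω ^ n) * f ω := by
  choose U hUK hU using exists_mem_ae_eq_pow_mul hS hf
  have hnorm : ∀ n, ‖c n • U n‖ ≤ ‖c n‖ * ‖f‖ := by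
    intro n
    rw [norm_smul]
    gcongr
    refine Lp.norm_le_norm_of_ae_le ?_
    filter_upwards [hU n, ae_mCirc_norm_eq_one] with ω h1 h2
    rw [h1, norm_mul, norm_pow, h2, one_pow, one_mul]
  have hsum : Summable fun n => c n • U n := Summable.of_norm_bounded (hc.mul_right _) hnorm
  have ht := hsum.hasSum.tendsto_sum_nat
  refine ⟨∑' n, c n • U n, hK.mem_of_tendsto ht (Filter.Eventually.of_forall fun N =>
    K.sum_mem fun n _ => K.smul_mem _ (hUK n)), ?_⟩
  refine ae_eq_of_tendsto_of_tendsto_ae ht ?_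
  have h4 : ∀ N : ℕ, ((∑ n ∈ Finset.range N, c n • U n : Lp ℂ 2 mCirc) : ℂ → ℂ)
      =ᵐ[mCirc] fun ω => (∑ n ∈ Finset.range N, c n * ω ^ n) * f ω := by
    intro N
    induction N with
    | zero =>
      simp only [Finset.range_zero, Finset.sum_empty]
      filter_upwards [Lp.coeFn_zero ℂ 2 mCirc] with ω h
      rw [h]
      simp
    | succ N ih =>
      simp_rw [Finset.sum_range_succ]
      refine (Lp.coeFn_add _ _).trans ?_
      filter_upwards [ih, Lp.coeFn_smul (c N) (U N), hU N] with ω h2 h3 h4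
      rw [Pi.add_apply, h2, h3, Pi.smul_apply, h4, smul_eq_mul]
      ring
  filter_upwards [ae_all_iff.2 h4, ae_mCirc_norm_eq_one] with ω h5 h6
  simp_rw [h5]
  refine (HasSum.tendsto_sum_nat ?_).mul_const _
  refine (Summable.of_norm ?_).hasSum
  simpa [h6] using hc

lemma gFun_two_re_neg {z : ℂ} (hz : ‖z‖ ≤ 1) (hz1 : z ≠ 1) (hz2 : z ^ 2 ≠ 1) :
    (gFun 2 z).re < 0 := by
  have h1 : (gFun 2 z).re = Real.log (‖1 + z‖ / 2) := by
    have h0 : 1 - z ≠ 0 := sub_ne_zero.2 hz1.symm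
    have h0' : 1 + z ≠ 0 := by
      intro h
      apply hz2
      linear_combination (z - 1) * h
    have h2 : 1 - z ^ 2 = (1 + z) * (1 - z) := by ring
    simp only [gFun, sub_re, log_re, ofReal_re]
    rw [h2, norm_mul, Real.log_mul (norm_ne_zero_iff.2 h0') (norm_ne_zero_iff.2 h0),
      Real.log_div (norm_ne_zero_iff.2 h0') two_ne_zero]
    push_cast
    ring
  have h3 : ‖1 + z‖ < 2 := by
    refine lt_of_le_of_ne ((norm_add_le _ _).trans (by rw [norm_one]; linarith)) fun h => ?_
    apply hz1
    have h4 : ‖1 + z‖ ^ 2 = 4 := by rw [h]; norm_num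
    have h5 : ‖z‖ ^ 2 ≤ 1 := pow_le_one₀ (norm_nonneg _) hz
    rw [← normSq_eq_norm_sq, normSq_apply] at h4 h5
    simp only [add_re, one_re, add_im, one_im, zero_add] at h4
    have h6 : z.re = 1 := by nlinarith [mul_self_nonneg (z.re - 1), mul_self_nonneg z.im]
    have h7 : z.im = 0 := by rw [h6] at h5; nlinarith [mul_self_nonneg z.im]
    exact Complex.ext h6 h7
  have h0' : 0 < ‖1 + z‖ := by
    rw [norm_pos_iff]
    intro h
    apply hz2
    linear_combination (z - 1) * h
  rw [h1]
  exact Real.log_neg (by positivity) (by linarith)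

lemma pow_ne_one_of_norm_lt_one {z : ℂ} (hz : ‖z‖ < 1) {k : ℕ} (hk : k ≠ 0) : z ^ k ≠ 1 := by
  intro h
  have := congrArg norm h
  rw [norm_pow, norm_one] at this
  exact (pow_lt_one₀ (norm_nonneg z) hz hk).ne this

/-- A regularised reciprocal of `hFun 2`. -/
noncomputable def cyclicMultiplier (ε : ℝ) (z : ℂ) : ℂ := (1 - z) / (gFun 2 z - ε)

lemma norm_gFun_two_sub_ge {ε : ℝ} (hε : 0 < ε) {z : ℂ} (hz : (gFun 2 z).re < 0) :
    ε ≤ ‖gFun 2 z - ε‖ ∧ ‖gFun 2 z‖ ≤ ‖gFun 2 z - ε‖ := by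
  constructor
  · have := abs_re_le_norm (gFun 2 z - ε)
    simp only [sub_re, ofReal_re] at this
    rw [abs_of_neg (by linarith)] at this
    linarith
  · rw [← sq_le_sq₀ (norm_nonneg _) (norm_nonneg _), ← normSq_eq_norm_sq, ← normSq_eq_norm_sq,
      normSq_apply, normSq_apply]
    simp only [sub_re, ofReal_re, sub_im, ofReal_im, sub_zero]
    nlinarith

lemma differentiableOn_cyclicMultiplier {ε : ℝ} (hε : 0 < ε) :
    DifferentiableOn ℂ (cyclicMultiplier ε) (Metric.ball 0 1) := by
  intro z hz
  rw [mem_ball_zero_iff] at hz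
  have hz1 : z ≠ 1 := by rintro rfl; simp at hz
  have hz2 := pow_ne_one_of_norm_lt_one hz two_ne_zero
  have h1 := one_sub_mem_slitPlane hz.le hz1
  have h2 : 1 - z ^ 2 ∈ slitPlane :=
    one_sub_mem_slitPlane (by rw [norm_pow]; exact pow_le_one₀ (norm_nonneg z) hz.le) hz2
  have h3 := gFun_two_re_neg hz.le hz1 hz2
  have h4 := (norm_gFun_two_sub_ge hε h3).1
  have h5 : gFun 2 z - ε ≠ 0 := norm_pos_iff.1 (hε.trans_le h4)
  have h6 : DifferentiableAt ℂ (fun z : ℂ => 1 - z ^ 2) z := by fun_prop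
  have h7 : DifferentiableAt ℂ (fun z : ℂ => 1 - z) z := by fun_prop
  have h8 : DifferentiableAt ℂ (gFun 2) z :=
    ((h6.clog h2).sub (h7.clog h1)).sub (differentiableAt_const _)
  exact (h7.div (h8.sub_const _) h5).differentiableWithinAt

lemma exists_mem_ae_eq_cyclicMultiplier (hK : IsClosed (K : Set (Lp ℂ 2 mCirc)))
    (hS : ∀ f ∈ K, ∀ g, IsShift f g → g ∈ K) {f : Lp ℂ 2 mCirc} (hf : f ∈ K)
    {ε : ℝ} (hε : 0 < ε) (m : ℕ) :
    ∃ u ∈ K, u =ᵐ[mCirc] fun ω => cyclicMultiplier ε (radius m * ω) * f ω := by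
  set d : ℕ → ℂ := fun n => (n.factorial : ℂ)⁻¹ * iteratedDeriv n (cyclicMultiplier ε) 0
  have hd : ∀ z : ℂ, ‖z‖ < 1 → HasSum (fun n => d n * z ^ n) (cyclicMultiplier ε z) := by
    intro z hz
    have := hasSum_taylorSeries_on_ball (r := 1)
      (by simpa using differentiableOn_cyclicMultiplier hε) (z := z) (by simpa using hz)
    refine hasSum_congr_of_eq this fun n => ?_
    simp only [sub_zero, smul_eq_mul, d]
    ring
  have hr : ‖(radius m : ℂ)‖ < 1 := by
    rw [norm_real, Real.norm_eq_abs, abs_of_nonneg (radius_nonneg m)]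
    exact radius_lt_one m
  obtain ⟨u, hu, h⟩ := exists_mem_ae_eq_tsum_mul hK hS hf (c := fun n => d n * (radius m : ℂ) ^ n)
    (hd _ hr).summable.norm
  refine ⟨u, hu, h.trans ?_⟩
  filter_upwards [ae_mCirc_norm_eq_one] with ω hω
  have hz : ‖(radius m : ℂ) * ω‖ < 1 := by rwa [norm_mul, hω, mul_one]
  rw [← (hd _ hz).tsum_eq]
  congr 1
  refine tsum_congr fun n => ?_
  rw [mul_pow]
  ring

lemma measurable_gFun (k : ℕ) : Measurable (gFun k) := by
  unfold gFun
  fun_prop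

lemma memLp_cyclicQuotient {ε : ℝ} (hε : 0 < ε) :
    MemLp (fun ω => gFun 2 ω / (gFun 2 ω - ε)) 2 mCirc := by
  have := measurable_gFun 2
  refine MemLp.of_bound (this.div (this.sub_const _)).aestronglyMeasurable 1 ?_
  filter_upwards [ae_mCirc_norm_eq_one, ae_mCirc_ne 1, ae_mCirc_pow_ne_one two_pos] with ω h1 h2 h3
  have h4 := norm_gFun_two_sub_ge hε (gFun_two_re_neg h1.le h2 h3)
  rw [norm_div]
  exact div_le_one_of_le₀ h4.2 (norm_nonneg _)

lemma cyclicQuotient_mem (hK : IsClosed (K : Set (Lp ℂ 2 mCirc)))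
    (hS : ∀ f ∈ K, ∀ g, IsShift f g → g ∈ K) {f : Lp ℂ 2 mCirc} (hf : f ∈ K)
    (hf2 : f =ᵐ[mCirc] hFun 2) {ε : ℝ} (hε : 0 < ε) :
    (memLp_cyclicQuotient hε).toLp ∈ K := by
  choose U hUK hU using exists_mem_ae_eq_cyclicMultiplier hK hS hf hε
  refine mem_of_tendsto_ae_of_dominated hK hUK (G := fun ω => 2 / ε * ‖f ω‖)
    ((Lp.memLp f).norm.const_mul _) (fun m => ?_) ?_
  · filter_upwards [hU m, ae_mCirc_norm_eq_one] with ω h1 h2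
    have hz : ‖(radius m : ℂ) * ω‖ < 1 := by
      rw [norm_mul, h2, mul_one, norm_real, Real.norm_eq_abs, abs_of_nonneg (radius_nonneg m)]
      exact radius_lt_one m
    have hz1 : (radius m : ℂ) * ω ≠ 1 := by
      intro h
      rw [h] at hz
      simp at hz
    have h4 := norm_gFun_two_sub_ge hε
      (gFun_two_re_neg hz.le hz1 (pow_ne_one_of_norm_lt_one hz two_ne_zero))
    rw [h1, norm_mul, cyclicMultiplier, norm_div]
    gcongr
    · refine (norm_sub_le _ _).trans ?_
      rw [norm_one]
      linarith
    · exact h4.1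
  · filter_upwards [ae_all_iff.2 hU, ae_mCirc_norm_eq_one, ae_mCirc_ne 1,
      ae_mCirc_pow_ne_one two_pos, hf2, (memLp_cyclicQuotient hε).coeFn_toLp]
      with ω h1 h2 h3 h4 h5 h6
    simp_rw [h1]
    rw [h6]
    have h7 := norm_gFun_two_sub_ge hε (gFun_two_re_neg h2.le h3 h4)
    have h8 : gFun 2 ω - ε ≠ 0 := norm_pos_iff.1 (hε.trans_le h7.1)
    have h9 : 1 - ω ≠ 0 := sub_ne_zero.2 h3.symm
    have h10 : gFun 2 ω / (gFun 2 ω - ε) = cyclicMultiplier ε ω * f ω := by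
      rw [h5, cyclicMultiplier, hFun]
      field_simp
    rw [h10]
    have h11 : ContinuousAt (cyclicMultiplier ε) ω := by
      have h12 : ContinuousAt (fun z : ℂ => 1 - z) ω := by fun_prop
      exact h12.div ((continuousAt_gFun h2.le h3 h4).sub continuousAt_const) h8
    exact (h11.tendsto.comp (tendsto_radius_mul ω)).mul_const _

/-- `hFun 2` is a cyclic vector for the shift. -/
lemma monomLp_zero_mem (hK : IsClosed (K : Set (Lp ℂ 2 mCirc)))
    (hS : ∀ f ∈ K, ∀ g, IsShift f g → g ∈ K) {f : Lp ℂ 2 mCirc} (hf : f ∈ K)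
    (hf2 : f =ᵐ[mCirc] hFun 2) : monomLp 0 ∈ K := by
  have hε : ∀ m : ℕ, 0 < 1 / ((m : ℝ) + 1) := fun m => by positivity
  refine mem_of_tendsto_ae_of_dominated hK (fun m => cyclicQuotient_mem hK hS hf hf2 (hε m))
    (G := fun _ => 1) (memLp_const _) (fun m => ?_) ?_
  · filter_upwards [ae_mCirc_norm_eq_one, ae_mCirc_ne 1, ae_mCirc_pow_ne_one two_pos,
      (memLp_cyclicQuotient (hε m)).coeFn_toLp] with ω h1 h2 h3 h5
    have h4 := norm_gFun_two_sub_ge (hε m) (gFun_two_re_neg h1.le h2 h3)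
    rw [h5, norm_div]
    exact div_le_one_of_le₀ h4.2 (norm_nonneg _)
  · filter_upwards [ae_mCirc_norm_eq_one, ae_mCirc_ne 1, ae_mCirc_pow_ne_one two_pos,
      ae_all_iff.2 fun m => (memLp_cyclicQuotient (hε m)).coeFn_toLp, monomLp_ae 0]
      with ω h1 h2 h3 h5 h6
    simp_rw [h5]
    rw [h6, pow_zero]
    have h7 : gFun 2 ω ≠ 0 := by
      intro h
      have := gFun_two_re_neg h1.le h2 h3
      rw [h] at this
      simp at this
    have h8 : Filter.Tendsto (fun m : ℕ => ((1 / ((m : ℝ) + 1) : ℝ) : ℂ)) Filter.atTop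
        (nhds ((0 : ℝ) : ℂ)) :=
      (continuous_ofReal.tendsto 0).comp tendsto_one_div_add_atTop_nhds_zero_nat
    have h9 := (tendsto_const_nhds (x := gFun 2 ω)).div (h8.const_sub (gFun 2 ω))
      (by simpa using h7)
    rw [ofReal_zero, sub_zero, div_self h7] at h9
    exact h9

end ShiftInvariant

lemma riemannHypothesis_of_zeta_ne_zero
    (h : ∀ w : ℂ, 1 / 2 < w.re → w.re < 1 → riemannZeta w ≠ 0) : RiemannHypothesis := by
  intro s hs htriv hs1
  have key : ∀ w : ℂ, 1 / 2 < w.re → riemannZeta w ≠ 0 := by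
    intro w hw
    rcases lt_or_ge w.re 1 with h1 | h1
    · exact h w hw h1
    · exact riemannZeta_ne_zero_of_one_le_re h1
  rcases lt_trichotomy s.re (1 / 2) with h1 | h1 | h1
  · exfalso
    have hw : 1 / 2 < (1 - s).re := by simp only [sub_re, one_re]; linarith
    have hs0 : s ≠ 0 := by
      rintro rfl
      rw [riemannZeta_zero] at hs
      norm_num at hs
    have hΓ : ∀ n : ℕ, 1 - s ≠ -n := by
      intro n hn
      rw [hn] at hw
      simp only [neg_re, natCast_re] at hw
      linarith [n.cast_nonneg (α := ℝ)]
    have hfe := riemannZeta_one_sub hΓ (by simpa using hs0)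
    rw [sub_sub_cancel, hs] at hfe
    have h2 : cos (Real.pi * (1 - s) / 2) = 0 := by
      have hΓ0 := Gamma_ne_zero hΓ
      have hz := key _ hw
      have hp : ((2 * Real.pi : ℝ) : ℂ) ^ (-(1 - s)) ≠ 0 := by
        rw [Ne, cpow_eq_zero_iff]
        have := Real.pi_pos.ne'
        simp [this]
      push_cast at hp
      simpa [hΓ0, hz, hp] using hfe.symm
    obtain ⟨k, hk⟩ := cos_eq_zero_iff.1 h2
    have hπ : (Real.pi : ℂ) ≠ 0 := by exact_mod_cast Real.pi_pos.ne'
    have h3 : 1 - s = 2 * k + 1 := by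
      have : (Real.pi : ℂ) * (1 - s) = Real.pi * (2 * k + 1) := by linear_combination 2 * hk
      exact mul_left_cancel₀ hπ this
    have h4 : s = -2 * k := by linear_combination -h3
    have h5 : s.re = -2 * k := by
      rw [h4]
      simp
    have hk0 : 0 < k := by
      have : (-1 : ℝ) < k := by linarith
      have hk1 : (-1 : ℤ) < k := by exact_mod_cast this
      rcases eq_or_ne k 0 with rfl | hk2
      · simp at h4
        exact absurd h4 hs0
      · omega
    apply htriv
    obtain ⟨m, hm⟩ : ∃ m : ℕ, k = m + 1 := ⟨k.toNat - 1, by omega⟩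
    refine ⟨m, ?_⟩
    rw [h4, hm]
    push_cast
    ring
  · exact h1
  · exact absurd hs (key s h1)

lemma norm_evalCoeff_sq_le {s : ℂ} (hs : -1 ≤ s.re) (n : ℕ) :
    ‖evalCoeff s (n + 1)‖ ^ 2 ≤ ‖s‖ ^ 2 * ((n : ℝ) + 1) ^ (-2 * s.re - 2) := by
  have h := norm_evalCoeff_succ_le hs n
  calc _ ≤ (‖s‖ * ((n : ℝ) + 1) ^ (-s.re - 1)) ^ 2 := by gcongr
    _ = _ := by
      rw [mul_pow, ← Real.rpow_natCast (((n : ℝ) + 1) ^ (-s.re - 1)), ← Real.rpow_mul (by positivity)]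
      congr 2
      push_cast
      ring

/-- The sequence representing the evaluation functional at `s`, for `-1/2 < re s`. -/
noncomputable def evalSeq (s : ℂ) (hs : -1 / 2 < s.re) : SeqL2 :=
  mkSeq (fun n => (starRingEnd ℂ) (evalCoeff s n)) (by
    simp only [RCLike.norm_conj]
    rw [← summable_nat_add_iff 1]
    exact Summable.of_nonneg_of_le (fun _ => by positivity)
      (norm_evalCoeff_sq_le (by linarith))
      ((summable_nat_add_one_rpow (by linarith)).mul_left _))

lemma inner_evalSeq {s : ℂ} (hs : -1 / 2 < s.re) (x : SeqL2) :
    inner ℂ (evalSeq s hs) x = ∑' n, evalCoeff s n * x n := by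
  rw [lp.inner_eq_tsum]
  refine tsum_congr fun n => ?_
  rw [evalSeq, mkSeq_apply, RCLike.inner_apply, RingHomCompTriple.comp_apply, RingHom.id_apply,
    mul_comm]

/-- The closed span of the coefficient sequences of the functions `hFun k`, `2 ≤ k`. -/
noncomputable def hSpan : Submodule ℂ SeqL2 :=
  (Submodule.span ℂ (hSeq '' {k : ℕ | 2 ≤ k})).topologicalClosure

lemma riemannHypothesis_of_single_mem (h : lp.single 2 0 (1 : ℂ) ∈ hSpan) :
    RiemannHypothesis := by
  refine riemannHypothesis_of_zeta_ne_zero fun w hw hw1 hζ => ?_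
  have hs : -1 / 2 < (w - 1).re := by simp only [sub_re, one_re]; linarith
  have hs0 : w - 1 ≠ 0 := by
    intro h
    rw [sub_eq_zero.1 h] at hw1
    simp at hw1
  have hle : hSpan ≤ (Submodule.span ℂ {evalSeq (w - 1) hs})ᗮ := by
    refine Submodule.topologicalClosure_minimal _ ?_ (Submodule.isClosed_orthogonal _)
    rw [Submodule.span_le]
    rintro _ ⟨k, hk, rfl⟩
    have hk0 : 0 < k := lt_of_lt_of_le two_pos hk
    rw [SetLike.mem_coe, Submodule.mem_orthogonal_singleton_iff_inner_right, inner_evalSeq]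
    have := hasSum_evalCoeff hk0 (s := w - 1) (by linarith) hs0
    rw [sub_add_cancel, hζ, zero_mul] at this
    rw [← this.tsum_eq]
    exact tsum_congr fun n => by rw [hSeq_apply hk0]
  have h1 := hle h
  rw [Submodule.mem_orthogonal_singleton_iff_inner_right, lp.inner_single_right] at h1
  rw [evalSeq, mkSeq_apply, evalCoeff_zero hs0] at h1
  simp at h1

lemma closure_span_eq_image {hk : ℕ → Lp ℂ 2 mCirc}
    (hk_ae : ∀ k, 2 ≤ k → (hk k : ℂ → ℂ) =ᵐ[mCirc] hFun k) :
    closure ((Submodule.span ℂ (hk '' {k : ℕ | 2 ≤ k}) :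
      Submodule ℂ (Lp ℂ 2 mCirc)) : Set (Lp ℂ 2 mCirc)) = circIso '' hSpan := by
  have h1 : hk '' {k : ℕ | 2 ≤ k} = circIso.toLinearMap '' (hSeq '' {k : ℕ | 2 ≤ k}) := by
    rw [Set.image_image]
    refine Set.image_congr fun k hk2 => Lp.ext ?_
    exact (hk_ae k hk2).trans (circIso_hSeq (lt_of_lt_of_le two_pos hk2)).symm
  rw [h1, Submodule.span_image, Submodule.map_coe, hSpan, Submodule.topologicalClosure_coe]
  exact (circIso.isometry.isClosedEmbedding.closure_image_eq _)

lemma shift_invariant_iff_of {hk : ℕ → Lp ℂ 2 mCirc}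
    (hk_ae : ∀ k, 2 ≤ k → (hk k : ℂ → ℂ) =ᵐ[mCirc] hFun k)
    (hRH : RiemannHypothesis → ∀ n, lp.single 2 n (1 : ℂ) ∈ hSpan) :
    RiemannHypothesis ↔
      (∀ f ∈ closure ((Submodule.span ℂ (hk '' {k : ℕ | 2 ≤ k}) :
          Submodule ℂ (Lp ℂ 2 mCirc)) : Set (Lp ℂ 2 mCirc)),
        ∀ g : Lp ℂ 2 mCirc, (g : ℂ → ℂ) =ᵐ[mCirc] (fun ω => ω * f ω) →
          g ∈ closure ((Submodule.span ℂ (hk '' {k : ℕ | 2 ≤ k}) :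
            Submodule ℂ (Lp ℂ 2 mCirc)) : Set (Lp ℂ 2 mCirc))) := by
  rw [closure_span_eq_image hk_ae]
  constructor
  · intro h
    have htop : (hSpan : Set SeqL2) = Set.univ := by
      refine Set.eq_univ_of_forall fun x => ?_
      have hx := lp.hasSum_single (p := 2) (by norm_num) x
      refine (Submodule.isClosed_topologicalClosure _).mem_of_tendsto hx
        (Filter.Eventually.of_forall fun s => Submodule.sum_mem _ fun n _ => ?_)
      have := hSpan.smul_mem (x n) (hRH h n)
      rwa [← lp.single_smul, smul_eq_mul, mul_one] at this
    rw [htop, Set.image_univ]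
    exact fun f hf g hg => mem_range_circIso_of_isShift hf hg
  · intro h
    have hmem : monomLp 0 ∈ hSpan.map circIso.toLinearMap := by
      refine monomLp_zero_mem (K := hSpan.map circIso.toLinearMap) ?_ h
        (f := circIso (hSeq 2)) ?_ (circIso_hSeq two_pos)
      · exact circIso.isometry.isClosedEmbedding.isClosedMap _
          (Submodule.isClosed_topologicalClosure _)
      · exact Submodule.mem_map_of_mem
          (Submodule.le_topologicalClosure _ (Submodule.subset_span ⟨2, le_refl 2, rfl⟩))
    obtain ⟨x, hx, hx0⟩ := hmem
    have h2 : x = lp.single 2 0 (1 : ℂ) :=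
      circIso.injective (hx0.trans (onIsometry_single orthonormal_monomLp 0).symm)
    exact riemannHypothesis_of_single_mem (h2 ▸ hx)

open scoped FourierTransform in
lemma fourier_exp_neg_half_abs (ξ : ℝ) :
    𝓕 (fun x : ℝ => cexp (-((|x| / 2 : ℝ) : ℂ))) ξ =
      (((1 / 4 + (2 * Real.pi * ξ) ^ 2)⁻¹ : ℝ) : ℂ) := by
  set c : ℂ := 2 * Real.pi * ξ * I with hc
  have hcre : c.re = 0 := by simp [hc]
  have ha : (-(1 / 2) - c).re < 0 := by rw [sub_re, hcre]; norm_num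
  have hb : 0 < ((1 / 2) - c).re := by rw [sub_re, hcre]; norm_num
  rw [Real.fourier_real_eq_integral_exp_smul]
  have e1 : ∀ x ∈ Set.Ioi (0 : ℝ), cexp (((-2 * Real.pi * x * ξ : ℝ) : ℂ) * I) •
      cexp (-((|x| / 2 : ℝ) : ℂ)) = cexp ((-(1 / 2) - c) * x) := by
    intro x hx
    rw [smul_eq_mul, ← Complex.exp_add, abs_of_pos hx, hc]
    push_cast; ring_nf
  have e2 : ∀ x ∈ Set.Iic (0 : ℝ), cexp (((-2 * Real.pi * x * ξ : ℝ) : ℂ) * I) •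
      cexp (-((|x| / 2 : ℝ) : ℂ)) = cexp (((1 / 2) - c) * x) := by
    intro x hx
    rw [smul_eq_mul, ← Complex.exp_add, abs_of_nonpos hx, hc]
    push_cast; ring_nf
  have i1 := (integrableOn_exp_mul_complex_Ioi ha 0).congr_fun
    (fun x hx => (e1 x hx).symm) measurableSet_Ioi
  have i2 := (integrableOn_exp_mul_complex_Iic hb 0).congr_fun
    (fun x hx => (e2 x hx).symm) measurableSet_Iic
  rw [← intervalIntegral.integral_Iic_add_Ioi i2 i1, setIntegral_congr_fun measurableSet_Ioi e1,
    setIntegral_congr_fun measurableSet_Iic e2, integral_exp_mul_complex_Ioi ha,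
    integral_exp_mul_complex_Iic hb]
  have h1 : (-(1 / 2) - c) ≠ 0 := fun h => by rw [h] at ha; simp at ha
  have h2 : ((1 / 2) - c) ≠ 0 := fun h => by rw [h] at hb; simp at hb
  have h3 : ((1 : ℂ) / 4 + (2 * Real.pi * ξ) ^ 2) = -(-(1 / 2) - c) * ((1 / 2) - c) := by
    rw [hc]; ring_nf; rw [I_sq]; ring
  push_cast
  rw [h3]
  simp only [mul_zero, Complex.exp_zero]
  have h4 : (1 / 2) - c = (-(1 / 2) - c) + 1 := by ring
  rw [h4] at h2 ⊢
  clear h4 h3 i1 i2 e1 e2 ha hb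
  generalize -(1 / 2) - c = p at h1 h2 ⊢
  field_simp
  ring

lemma integrable_inv_quarter_add_sq :
    Integrable fun ξ : ℝ => (1 / 4 + (2 * Real.pi * ξ) ^ 2)⁻¹ := by
  have h := (integrable_inv_one_add_sq.comp_mul_left' (R := 4 * Real.pi)
    (by positivity)).const_mul 4
  refine h.congr (Filter.Eventually.of_forall fun ξ => ?_)
  simp only
  rw [← div_eq_mul_inv, ← one_div, div_eq_div_iff (by positivity) (by positivity)]
  ring

open scoped FourierTransform in
lemma integral_cexp_mul_inv_quarter_add_sq (y : ℝ) :
    ∫ ξ : ℝ, cexp ((2 * Real.pi * ξ * y : ℝ) * I) * (((1 / 4 + (2 * Real.pi * ξ) ^ 2)⁻¹ : ℝ) : ℂ) =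
      cexp (-((|y| / 2 : ℝ) : ℂ)) := by
  set f : ℝ → ℂ := fun x : ℝ => cexp (-((|x| / 2 : ℝ) : ℂ)) with hf
  have hFf : 𝓕 f = fun ξ : ℝ => (((1 / 4 + (2 * Real.pi * ξ) ^ 2)⁻¹ : ℝ) : ℂ) :=
    funext fourier_exp_neg_half_abs
  have hcont : Continuous f := by fun_prop
  have hint : Integrable f := by
    rw [← integrableOn_univ, ← Set.Iic_union_Ioi (a := (0 : ℝ))]
    refine IntegrableOn.union ?_ ?_
    · refine (integrableOn_exp_mul_complex_Iic (a := 1 / 2) (by norm_num) 0).congr_fun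
        (fun x hx => ?_) measurableSet_Iic
      simp only [hf]
      rw [abs_of_nonpos hx]
      push_cast; ring_nf
    · refine (integrableOn_exp_mul_complex_Ioi (a := -(1 / 2)) (by norm_num) 0).congr_fun
        (fun x hx => ?_) measurableSet_Ioi
      simp only [hf]
      rw [abs_of_pos hx]
      push_cast; ring_nf
  have h := congrFun (hcont.fourierInv_fourier_eq hint
    (by rw [hFf]; exact integrable_inv_quarter_add_sq.ofReal)) y
  rw [hFf, Real.fourierInv_eq'] at h
  refine Eq.trans ?_ h
  refine integral_congr_ae (Filter.Eventually.of_forall fun ξ => ?_)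
  simp only [smul_eq_mul, RCLike.inner_apply, conj_trivial]
  congr 4
  ring

/-- The parametrization `ξ ↦ -1/2 + 2πiξ` of the vertical line `Re s = -1/2`. -/
noncomputable def edgePt (ξ : ℝ) : ℂ := -(1 / 2) + 2 * Real.pi * ξ * I

lemma edgePt_re (ξ : ℝ) : (edgePt ξ).re = -(1 / 2) := by simp [edgePt]

lemma edgePt_im (ξ : ℝ) : (edgePt ξ).im = 2 * Real.pi * ξ := by simp [edgePt]

lemma edgePt_ne_zero (ξ : ℝ) : edgePt ξ ≠ 0 := fun h => by
  have := edgePt_re ξ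
  rw [h] at this
  norm_num at this

lemma continuous_edgePt : Continuous edgePt := by unfold edgePt; fun_prop

lemma norm_edgePt_sq (ξ : ℝ) : ‖edgePt ξ‖ ^ 2 = 1 / 4 + (2 * Real.pi * ξ) ^ 2 := by
  rw [Complex.sq_norm, normSq_apply, edgePt_re, edgePt_im]; ring

lemma half_le_norm_edgePt (ξ : ℝ) : 1 / 2 ≤ ‖edgePt ξ‖ := by
  have := Complex.abs_re_le_norm (edgePt ξ)
  rw [edgePt_re] at this
  norm_num at this ⊢
  linarith

lemma continuous_natCast_cpow_neg_edgePt (n : ℕ) :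
    Continuous fun ξ : ℝ => (n : ℂ) ^ (-edgePt ξ) := by
  rcases Nat.eq_zero_or_pos n with rfl | hn
  · have : (fun ξ : ℝ => ((0 : ℕ) : ℂ) ^ (-edgePt ξ)) = fun _ => 0 := by
      ext ξ; simp [edgePt_ne_zero]
    rw [this]; exact continuous_const
  · have : (n : ℂ) ≠ 0 := by exact_mod_cast hn.ne'
    exact (continuous_edgePt.neg).const_cpow (Or.inl this)

lemma norm_natCast_cpow_neg_edgePt_le (n : ℕ) (ξ : ℝ) :
    ‖(n : ℂ) ^ (-edgePt ξ)‖ ≤ (n : ℝ) ^ (1 / 2 : ℝ) := by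
  rcases Nat.eq_zero_or_pos n with rfl | hn
  · simp [edgePt_ne_zero]
  · rw [Complex.norm_natCast_cpow_of_pos hn, neg_re, edgePt_re, neg_neg]

lemma memLp_inv_edgePt : MemLp (fun ξ : ℝ => (edgePt ξ)⁻¹) 2 := by
  have hc : Continuous fun ξ : ℝ => (edgePt ξ)⁻¹ := continuous_edgePt.inv₀ edgePt_ne_zero
  rw [memLp_two_iff_integrable_sq_norm hc.aestronglyMeasurable]
  refine integrable_inv_quarter_add_sq.congr (Filter.Eventually.of_forall fun ξ => ?_)
  simp only [norm_inv, inv_pow, norm_edgePt_sq]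

lemma memLp_mul_inv_edgePt {f : ℝ → ℂ} (hf : Continuous f) {C : ℝ} (hC : ∀ ξ, ‖f ξ‖ ≤ C) :
    MemLp (fun ξ : ℝ => f ξ / edgePt ξ) 2 := by
  refine MemLp.of_le_mul (c := C) memLp_inv_edgePt
    (hf.div continuous_edgePt edgePt_ne_zero).aestronglyMeasurable
    (Filter.Eventually.of_forall fun ξ => ?_)
  rw [norm_div, norm_inv, div_eq_mul_inv]
  gcongr
  exact hC ξ

lemma memLp_cpow_div_edgePt (n : ℕ) :
    MemLp (fun ξ : ℝ => (n : ℂ) ^ (-edgePt ξ) / edgePt ξ) 2 :=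
  memLp_mul_inv_edgePt (continuous_natCast_cpow_neg_edgePt n) (norm_natCast_cpow_neg_edgePt_le n)

/-- The function `ξ ↦ n ^ (-s) / s`, `s = -1/2 + 2πiξ`, as an element of `L²(ℝ)`. -/
noncomputable def cpowLp (n : ℕ) : Lp ℂ 2 (volume : Measure ℝ) := (memLp_cpow_div_edgePt n).toLp

lemma cpowLp_ae_eq (n : ℕ) :
    cpowLp n =ᵐ[volume] fun ξ : ℝ => (n : ℂ) ^ (-edgePt ξ) / edgePt ξ :=
  (memLp_cpow_div_edgePt n).coeFn_toLp

lemma inner_cpowLp (m n : ℕ) : inner ℂ (cpowLp m) (cpowLp n) = ((min m n : ℕ) : ℂ) := by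
  rw [L2.inner_def]
  have h0 : ∫ ξ : ℝ, inner ℂ (cpowLp m ξ) (cpowLp n ξ) = ∫ ξ : ℝ,
      (starRingEnd ℂ) ((m : ℂ) ^ (-edgePt ξ)) * (n : ℂ) ^ (-edgePt ξ) *
        (((1 / 4 + (2 * Real.pi * ξ) ^ 2)⁻¹ : ℝ) : ℂ) := by
    refine integral_congr_ae ?_
    filter_upwards [cpowLp_ae_eq m, cpowLp_ae_eq n] with ξ h1 h2
    rw [h1, h2, RCLike.inner_apply, ← norm_edgePt_sq, ofReal_inv, ofReal_pow, ← conj_mul', map_div₀]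
    have h3 := edgePt_ne_zero ξ
    have h4 : (starRingEnd ℂ) (edgePt ξ) ≠ 0 := by simpa using h3
    field_simp
  rw [h0]
  rcases Nat.eq_zero_or_pos m with rfl | hm
  · simp [edgePt_ne_zero]
  rcases Nat.eq_zero_or_pos n with rfl | hn
  · simp [edgePt_ne_zero]
  have h1 : ∀ ξ : ℝ, (starRingEnd ℂ) ((m : ℂ) ^ (-edgePt ξ)) * (n : ℂ) ^ (-edgePt ξ) *
        (((1 / 4 + (2 * Real.pi * ξ) ^ 2)⁻¹ : ℝ) : ℂ) =
      cexp (((Real.log m + Real.log n) / 2 : ℝ)) *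
        (cexp ((2 * Real.pi * ξ * (Real.log m - Real.log n) : ℝ) * I) *
        (((1 / 4 + (2 * Real.pi * ξ) ^ 2)⁻¹ : ℝ) : ℂ)) := by
    intro ξ
    rw [← mul_assoc, cpow_def_of_ne_zero (by exact_mod_cast hm.ne'),
      cpow_def_of_ne_zero (by exact_mod_cast hn.ne'), ← exp_conj, ← Complex.exp_add,
      ← Complex.exp_add, ← natCast_log, ← natCast_log]
    congr 2
    simp only [edgePt, map_mul, map_neg, map_add, conj_ofReal, conj_I, map_div₀, map_one,
      map_ofNat]
    push_cast
    ring
  simp_rw [h1]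
  rw [integral_const_mul, integral_cexp_mul_inv_quarter_add_sq, ← Complex.exp_add, ← ofReal_neg,
    ← ofReal_add, ← ofReal_exp]
  have hm' : (0 : ℝ) < m := by exact_mod_cast hm
  have hn' : (0 : ℝ) < n := by exact_mod_cast hn
  have key : (Real.log m + Real.log n) / 2 + -(|Real.log m - Real.log n| / 2) =
      Real.log ((min m n : ℕ) : ℝ) := by
    rcases le_total m n with h | h
    · rw [min_eq_left h, abs_of_nonpos (sub_nonpos.2 (Real.log_le_log hm' (by exact_mod_cast h)))]
      ring
    · rw [min_eq_right h, abs_of_nonneg (sub_nonneg.2 (Real.log_le_log hn' (by exact_mod_cast h)))]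
      ring
  rw [key, Real.exp_log (by exact_mod_cast lt_min hm hn), ofReal_natCast]

/-- The orthonormal sequence `ξ ↦ (n ^ (-s) - (n + 1) ^ (-s)) / s`, `s = -1/2 + 2πiξ`. -/
noncomputable def edgeLp (n : ℕ) : Lp ℂ 2 (volume : Measure ℝ) := cpowLp n - cpowLp (n + 1)

lemma edgeLp_ae_eq (n : ℕ) :
    edgeLp n =ᵐ[volume] fun ξ : ℝ => evalCoeff (edgePt ξ) n / edgePt ξ := by
  filter_upwards [Lp.coeFn_sub (cpowLp n) (cpowLp (n + 1)), cpowLp_ae_eq n, cpowLp_ae_eq (n + 1)]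
    with ξ h1 h2 h3
  rw [edgeLp, h1, Pi.sub_apply, h2, h3, evalCoeff, sub_div]
  push_cast
  rfl

lemma orthonormal_edgeLp : Orthonormal ℂ edgeLp := by
  rw [orthonormal_iff_ite]
  intro m n
  simp only [edgeLp, inner_sub_left, inner_sub_right, inner_cpowLp]
  rcases lt_trichotomy m n with h | h | h
  · rw [if_neg h.ne, min_eq_left (by omega), min_eq_left (by omega), min_eq_left (by omega),
      min_eq_left (by omega)]
    ring
  · subst h
    rw [if_pos rfl]
    simp
  · rw [if_neg h.ne', min_eq_right (by omega), min_eq_right (by omega), min_eq_right (by omega),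
      min_eq_right (by omega)]
    ring

/-- The isometry `SeqL2 → L²(ℝ)` sending the standard basis to `edgeLp`. -/
noncomputable def edgeIso : SeqL2 →ₗᵢ[ℂ] Lp ℂ 2 (volume : Measure ℝ) :=
  onIsometry orthonormal_edgeLp

lemma edgeIso_single (n : ℕ) : edgeIso (lp.single 2 n (1 : ℂ)) = edgeLp n :=
  onIsometry_single _ n

lemma edgeIso_hSeq {k : ℕ} (hk : 0 < k) : edgeIso (hSeq k) =ᵐ[volume] fun ξ : ℝ =>
    riemannZeta (1 + edgePt ξ) / edgePt ξ * (1 - (k : ℂ) ^ (-edgePt ξ)) := by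
  refine onIsometry_ae_eq _ edgeLp_ae_eq (Filter.Eventually.of_forall fun ξ => ?_)
  have h := (hasSum_evalCoeff (s := edgePt ξ) hk (by rw [edgePt_re]; norm_num)
    (edgePt_ne_zero ξ)).mul_left (edgePt ξ)⁻¹
  have h2 : riemannZeta (1 + edgePt ξ) / edgePt ξ * (1 - (k : ℂ) ^ (-edgePt ξ)) =
      (edgePt ξ)⁻¹ * (riemannZeta (edgePt ξ + 1) * (1 - (k : ℂ) ^ (-edgePt ξ))) := by
    rw [add_comm 1]; ring
  rw [h2]
  refine hasSum_congr_of_eq h fun n => ?_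
  rw [hSeq_apply hk]; ring

lemma integral_mul_div_edgePt_eq_zero
    (core : ∀ F : ℝ → ℂ, MemLp F 2 volume →
      (∀ k : ℕ, 2 ≤ k → ∫ ξ : ℝ, F ξ * (riemannZeta (1 + edgePt ξ) / edgePt ξ *
        (1 - (k : ℂ) ^ (-edgePt ξ))) = 0) → ∫ ξ : ℝ, F ξ * (edgePt ξ)⁻¹ = 0)
    {F : ℝ → ℂ} (hF : MemLp F 2 volume)
    (h : ∀ k : ℕ, 2 ≤ k → ∫ ξ : ℝ, F ξ * (riemannZeta (1 + edgePt ξ) / edgePt ξ *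
        (1 - (k : ℂ) ^ (-edgePt ξ))) = 0) (n : ℕ) :
    ∫ ξ : ℝ, F ξ * ((n : ℂ) ^ (-edgePt ξ) / edgePt ξ) = 0 := by
  rcases Nat.eq_zero_or_pos n with rfl | hn
  · simp [edgePt_ne_zero]
  have hn0 : (n : ℂ) ≠ 0 := by exact_mod_cast hn.ne'
  have hF' : MemLp (fun ξ : ℝ => F ξ * (n : ℂ) ^ (-edgePt ξ)) 2 volume := by
    refine MemLp.of_le_mul (c := (n : ℝ) ^ (1 / 2 : ℝ)) hF
      (hF.1.mul (continuous_natCast_cpow_neg_edgePt n).aestronglyMeasurable)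
      (Filter.Eventually.of_forall fun ξ => ?_)
    rw [norm_mul, mul_comm]
    gcongr
    exact norm_natCast_cpow_neg_edgePt_le n ξ
  have hint : ∀ k : ℕ, 2 ≤ k → Integrable fun ξ : ℝ => F ξ * (riemannZeta (1 + edgePt ξ) /
      edgePt ξ * (1 - (k : ℂ) ^ (-edgePt ξ))) := by
    intro k hk
    have h1 : MemLp (fun ξ : ℝ => riemannZeta (1 + edgePt ξ) /
      edgePt ξ * (1 - (k : ℂ) ^ (-edgePt ξ))) 2 volume :=
      (memLp_congr_ae (edgeIso_hSeq (by omega))).1 (Lp.memLp (edgeIso (hSeq k)))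
    exact hF.integrable_mul h1
  rw [← core _ hF' ?_]
  · refine integral_congr_ae (Filter.Eventually.of_forall fun ξ => ?_)
    simp only
    ring
  intro k hk
  have e : ∀ ξ : ℝ, F ξ * (n : ℂ) ^ (-edgePt ξ) * (riemannZeta (1 + edgePt ξ) / edgePt ξ *
        (1 - (k : ℂ) ^ (-edgePt ξ))) =
      F ξ * (riemannZeta (1 + edgePt ξ) / edgePt ξ * (1 - ((n * k : ℕ) : ℂ) ^ (-edgePt ξ))) -
      F ξ * (riemannZeta (1 + edgePt ξ) / edgePt ξ * (1 - (n : ℂ) ^ (-edgePt ξ))) := by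
    intro ξ
    rw [Nat.cast_mul, natCast_mul_natCast_cpow]
    ring
  simp_rw [e]
  have hnk : 2 ≤ n * k := by nlinarith
  by_cases hn1 : n = 1
  · subst hn1
    simpa using h k hk
  · rw [integral_sub (hint _ hnk) (hint n (by omega)), h _ hnk, h n (by omega), sub_zero]

lemma single_mem_hSpan_of
    (core : ∀ F : ℝ → ℂ, MemLp F 2 volume →
      (∀ k : ℕ, 2 ≤ k → ∫ ξ : ℝ, F ξ * (riemannZeta (1 + edgePt ξ) / edgePt ξ *
        (1 - (k : ℂ) ^ (-edgePt ξ))) = 0) → ∫ ξ : ℝ, F ξ * (edgePt ξ)⁻¹ = 0) (n : ℕ) :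
    lp.single 2 n (1 : ℂ) ∈ hSpan := by
  have hcl : IsClosed (hSpan : Set SeqL2) := Submodule.isClosed_topologicalClosure _
  have : CompleteSpace hSpan := hcl.completeSpace_coe
  rw [← hSpan.orthogonal_orthogonal, Submodule.mem_orthogonal]
  intro y hy
  rw [Submodule.mem_orthogonal'] at hy
  set F : ℝ → ℂ := fun ξ => (starRingEnd ℂ) (edgeIso y ξ) with hFdef
  have hF : MemLp F 2 volume := (Lp.memLp (edgeIso y)).star
  have hinner : ∀ x : SeqL2, ∀ f : ℝ → ℂ, edgeIso x =ᵐ[volume] f →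
      inner ℂ y x = ∫ ξ : ℝ, F ξ * f ξ := by
    intro x f hf
    rw [← edgeIso.inner_map_map, L2.inner_def]
    refine integral_congr_ae ?_
    filter_upwards [hf] with ξ h1
    rw [RCLike.inner_apply, h1, mul_comm]
  have h : ∀ k : ℕ, 2 ≤ k → ∫ ξ : ℝ, F ξ * (riemannZeta (1 + edgePt ξ) / edgePt ξ *
        (1 - (k : ℂ) ^ (-edgePt ξ))) = 0 := by
    intro k hk
    rw [← hinner _ _ (edgeIso_hSeq (by omega))]
    exact hy _ (Submodule.le_topologicalClosure _ (Submodule.subset_span ⟨k, hk, rfl⟩))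
  have hv := integral_mul_div_edgePt_eq_zero core hF h
  have hi : ∀ m : ℕ, Integrable fun ξ : ℝ => F ξ * ((m : ℂ) ^ (-edgePt ξ) / edgePt ξ) :=
    fun m => hF.integrable_mul (memLp_cpow_div_edgePt m)
  rw [hinner _ _ ((edgeIso_single n).symm ▸ edgeLp_ae_eq n)]
  have e : ∀ ξ : ℝ, F ξ * (evalCoeff (edgePt ξ) n / edgePt ξ) =
      F ξ * ((n : ℂ) ^ (-edgePt ξ) / edgePt ξ) -
        F ξ * (((n + 1 : ℕ) : ℂ) ^ (-edgePt ξ) / edgePt ξ) := by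
    intro ξ
    rw [evalCoeff]
    push_cast
    ring
  simp_rw [e]
  rw [integral_sub (hi n) (hi (n + 1)), hv, hv, sub_zero]

lemma differentiableOn_integral_of_dominated {α : Type*} [MeasurableSpace α] {μ : Measure α}
    {G : ℂ → α → ℂ} {c : ℂ} {r : ℝ} {bound : α → ℝ}
    (hm : ∀ u ∈ Metric.ball c r, AEStronglyMeasurable (G u) μ) (hb : Integrable bound μ)
    (hle : ∀ u ∈ Metric.ball c r, ∀ t, ‖G u t‖ ≤ bound t)
    (hd : ∀ t, DifferentiableOn ℂ (fun u => G u t) (Metric.ball c r)) :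
    DifferentiableOn ℂ (fun u => ∫ t, G u t ∂μ) (Metric.ball c r) := by
  intro u hu
  obtain ⟨ρ, hρ, hsub⟩ := Metric.isOpen_iff.1 Metric.isOpen_ball u hu
  have hat : ∀ t, ∀ v ∈ Metric.ball u ρ, HasDerivAt (fun u => G u t) (deriv (fun u => G u t) v) v :=
    fun t v hv => ((hd t).differentiableAt
      (Metric.isOpen_ball.mem_nhds (hsub hv))).hasDerivAt
  have hmain := hasDerivAt_integral_of_dominated_loc_of_deriv_le (μ := μ) (F := G) (x₀ := u)
    (s := Metric.ball u (ρ / 2)) (bound := fun t => bound t / (ρ / 4))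
    (F' := fun v t => deriv (fun u => G u t) v) (Metric.ball_mem_nhds _ (by positivity))
    (by
      filter_upwards [Metric.isOpen_ball.mem_nhds hu] with v hv using hm v hv)
    (hb.mono' (hm u hu) (Filter.Eventually.of_forall (hle u hu))) ?_ ?_ (hb.div_const _) ?_
  · exact hmain.2.differentiableAt.differentiableWithinAt
  · have hseq : Filter.Tendsto (fun n : ℕ => ((ρ / (n + 2) : ℝ) : ℂ)) Filter.atTop
        (nhdsWithin 0 {0}ᶜ) := by
      refine tendsto_nhdsWithin_iff.2 ⟨?_, Filter.Eventually.of_forall fun n => ?_⟩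
      · rw [← ofReal_zero]
        refine (continuous_ofReal.tendsto 0).comp ?_
        refine Filter.Tendsto.div_atTop tendsto_const_nhds ?_
        exact Filter.tendsto_atTop_add_const_right _ _ tendsto_natCast_atTop_atTop
      · simp only [Set.mem_compl_iff, Set.mem_singleton_iff, ofReal_eq_zero]
        positivity
    refine aestronglyMeasurable_of_tendsto_ae Filter.atTop
      (f := fun (n : ℕ) t => ((ρ / (n + 2) : ℝ) : ℂ)⁻¹ • (G (u + ((ρ / (n + 2) : ℝ) : ℂ)) t - G u t))
      (fun n => ?_) (Filter.Eventually.of_forall fun t => ?_)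
    · have hmem : u + ((ρ / (n + 2) : ℝ) : ℂ) ∈ Metric.ball c r := hsub ?_
      · exact ((hm _ hmem).sub (hm u hu)).const_smul (((ρ / (n + 2) : ℝ) : ℂ)⁻¹)
      rw [Metric.mem_ball, dist_self_add_left, norm_real, Real.norm_of_nonneg (by positivity),
        div_lt_iff₀ (by positivity)]
      nlinarith [(Nat.cast_nonneg n : (0 : ℝ) ≤ n)]
    · exact (hat t u (Metric.mem_ball_self hρ)).tendsto_slope_zero.comp hseq
  · refine Filter.Eventually.of_forall fun t v hv => ?_
    have hv' := Metric.mem_ball.1 hv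
    refine norm_deriv_le_of_forall_mem_sphere_norm_le (by positivity) ?_ ?_
    · refine DifferentiableOn.diffContOnCl ?_
      refine (hd t).mono (Set.Subset.trans ?_ hsub)
      rw [closure_ball _ (by positivity)]
      intro z hz
      rw [Metric.mem_closedBall] at hz
      rw [Metric.mem_ball]
      linarith [dist_triangle z v u]
    · intro z hz
      refine hle z (hsub ?_) t
      rw [mem_sphere_iff_norm, ← dist_eq_norm] at hz
      rw [Metric.mem_ball]
      linarith [dist_triangle z v u]
  · refine Filter.Eventually.of_forall fun t v hv => hat t v ?_
    exact Metric.ball_subset_ball (by linarith) hv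

lemma exists_log_of_ne_zero {f : ℂ → ℂ} {c : ℂ} {R M : ℝ} (hR : 0 < R) (hM : 0 < M)
    (hf : DifferentiableOn ℂ f (Metric.ball c R)) (h0 : ∀ z ∈ Metric.ball c R, f z ≠ 0)
    (hle : ∀ z ∈ Metric.ball c R, ‖f z‖ ≤ Real.exp M * ‖f c‖) :
    ∃ L : ℂ → ℂ, DifferentiableOn ℂ L (Metric.ball c R) ∧
      (∀ z ∈ Metric.ball c R, f z = f c * cexp (L z)) ∧
      ∀ z ∈ Metric.ball c R, ‖L z‖ ≤ 2 * M * ‖z - c‖ / (R - ‖z - c‖) := by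
  have hc : c ∈ Metric.ball c R := Metric.mem_ball_self hR
  have hq : DifferentiableOn ℂ (fun z => deriv f z / f z) (Metric.ball c R) :=
    (hf.deriv Metric.isOpen_ball).div hf h0
  obtain ⟨L, hLc, hL⟩ := hq.isExactOn_ball.with_val_at c 0
  have hLd : DifferentiableOn ℂ L (Metric.ball c R) :=
    fun z hz => (hL z hz).differentiableAt.differentiableWithinAt
  have hfL : ∀ z ∈ Metric.ball c R, f z = f c * cexp (L z) := by
    intro z hz
    have hder : ∀ w ∈ Metric.ball c R, HasDerivAt (fun z => f z * cexp (-L z)) 0 w := by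
      intro w hw
      have h1 := (hf.differentiableAt (Metric.isOpen_ball.mem_nhds hw)).hasDerivAt
      have h2 := h1.mul (hL w hw).neg.cexp
      have h3 : deriv f w * cexp ((-L) w) + f w * (cexp ((-L) w) * -(deriv f w / f w)) = 0 := by
        have := h0 w hw
        field_simp
        ring
      rw [h3] at h2
      exact h2
    have h3 := (convex_ball c R).is_const_of_fderivWithin_eq_zero (𝕜 := ℂ)
      (f := fun z => f z * cexp (-L z))
      (fun w hw => (hder w hw).differentiableAt.differentiableWithinAt)
      (fun w hw => by
        rw [fderivWithin_of_isOpen Metric.isOpen_ball hw]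
        have := (hder w hw).hasFDerivAt.fderiv
        rw [this]
        ext
        simp) hz hc
    simp only [hLc, neg_zero, Complex.exp_zero, mul_one] at h3
    rw [← h3, mul_assoc, ← Complex.exp_add, neg_add_cancel, Complex.exp_zero, mul_one]
  refine ⟨L, hLd, hfL, fun z hz => ?_⟩
  have hmaps : ∀ w ∈ Metric.ball (0 : ℂ) R, c + w ∈ Metric.ball c R := by
    intro w hw
    simpa using hw
  have hz' : z - c ∈ Metric.ball (0 : ℂ) R := by
    rwa [mem_ball_zero_iff, ← mem_ball_iff_norm]
  have := borelCaratheodory_zero (f := fun w => L (c + w)) hM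
    (hLd.comp (by fun_prop) hmaps) (fun w hw => ?_) hR hz' (by simpa using hLc)
  · simpa using this
  · have h1 := hfL _ (hmaps w hw)
    have h2 := hle _ (hmaps w hw)
    rw [h1, norm_mul, mul_comm, norm_exp] at h2
    exact Real.exp_le_exp.1 (le_of_mul_le_mul_right h2 (norm_pos_iff.2 (h0 c hc)))

lemma norm_div_le_exp_of_log {f L : ℂ → ℂ} {c : ℂ} {R M δ : ℝ} (hM : 0 < M) (hδ : 0 < δ)
    (hL : DifferentiableOn ℂ L (Metric.ball c R))
    (hfL : ∀ z ∈ Metric.ball c R, f z = f c * cexp (L z))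
    (hLle : ∀ z ∈ Metric.ball c R, ‖L z‖ ≤ 2 * M * ‖z - c‖ / (R - ‖z - c‖)) (hc : f c ≠ 0)
    {a b : ℂ} (ha : ‖a - c‖ ≤ R - 2 * δ) (hb : ‖b - c‖ ≤ R - 2 * δ) :
    ‖f a / f b‖ ≤ Real.exp (2 * M * R / δ / δ * ‖a - b‖) := by
  have hR : 2 * δ ≤ R := by linarith [norm_nonneg (a - c)]
  have hsub : Metric.closedBall c (R - 2 * δ) ⊆ Metric.ball c R :=
    fun z hz => by
      rw [Metric.mem_closedBall] at hz
      rw [Metric.mem_ball]; linarith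
  have ha' : a ∈ Metric.closedBall c (R - 2 * δ) := by rwa [mem_closedBall_iff_norm]
  have hb' : b ∈ Metric.closedBall c (R - 2 * δ) := by rwa [mem_closedBall_iff_norm]
  have h1 : ‖L a - L b‖ ≤ 2 * M * R / δ / δ * ‖a - b‖ := by
    refine (convex_closedBall c (R - 2 * δ)).norm_image_sub_le_of_norm_deriv_le (𝕜 := ℂ)
      (fun z hz => hL.differentiableAt (Metric.isOpen_ball.mem_nhds (hsub hz))) (fun z hz => ?_)
      hb' ha'
    rw [Metric.mem_closedBall] at hz
    refine norm_deriv_le_of_forall_mem_sphere_norm_le hδ (DifferentiableOn.diffContOnCl ?_)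
      fun w hw => ?_
    · refine hL.mono fun w hw => ?_
      rw [closure_ball _ hδ.ne', Metric.mem_closedBall] at hw
      rw [Metric.mem_ball]
      linarith [dist_triangle w z c]
    · rw [Metric.mem_sphere] at hw
      have hw2 : ‖w - c‖ ≤ R - δ := by
        rw [← dist_eq_norm]; linarith [dist_triangle w z c]
      refine (hLle w (by rw [mem_ball_iff_norm]; linarith)).trans ?_
      have h3 : 0 ≤ 2 * M * R := by nlinarith
      gcongr
      · linarith
      · linarith
  rw [hfL a (hsub ha'), hfL b (hsub hb'), mul_div_mul_left _ _ hc, ← Complex.exp_sub, norm_exp]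
  exact Real.exp_le_exp.2 (((le_abs_self _).trans (abs_re_le_norm _)).trans h1)

lemma zeta₁_eq_sub_one_mul {s : ℂ} (hs : s ≠ 1) : riemannZeta₁ s = (s - 1) * riemannZeta s := by
  rw [riemannZeta_eq_inv_sub_mul hs, mul_inv_cancel_left₀ (sub_ne_zero.2 hs)]

lemma zeta₁_ne_zero (hRH : RiemannHypothesis) {s : ℂ} (hs : 1 / 2 < s.re) : riemannZeta₁ s ≠ 0 := by
  intro h
  have h1 : s ≠ 1 := fun h1 => by rw [h1, riemannZeta₁_one] at h; exact one_ne_zero h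
  have h2 : riemannZeta s = 0 := by rw [riemannZeta_eq_inv_sub_mul h1, h, mul_zero]
  have := hRH s h2 (fun ⟨n, hn⟩ => ?_) h1
  · linarith
  · rw [hn] at hs
    simp at hs
    linarith [(Nat.cast_nonneg n : (0 : ℝ) ≤ n)]

lemma norm_zeta_sub_one_le {s : ℂ} (hs : 2 ≤ s.re) : ‖riemannZeta s - 1‖ ≤ 2 / 3 := by
  have h1 := hasSum_zeta (s := s) (by linarith)
  have h2 := hasSum_zeta (s := 2) (by norm_num)
  have h1' := (hasSum_nat_add_iff' 1).2 h1
  have h2' := (hasSum_nat_add_iff' 1).2 (hasSum_re h2)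
  simp only [Finset.range_one, Finset.sum_singleton, Nat.cast_zero, zero_add, one_cpow,
    one_re] at h1' h2'
  have h3 : ‖riemannZeta s - 1‖ ≤ (riemannZeta 2).re - 1 := by
    rw [← h1'.tsum_eq, ← h2'.tsum_eq]
    refine tsum_of_norm_bounded h2'.summable.hasSum fun n => ?_
    rw [natCast_add_one_cpow_norm, neg_re]
    have h4 : (((n + 1 : ℕ) : ℂ) + 1) ^ (-2 : ℂ) = ((((n + 1 : ℕ) : ℝ) + 1) ^ (-2 : ℝ) : ℝ) := by
      rw [ofReal_cpow (by positivity)]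
      push_cast
      rfl
    rw [h4, ofReal_re]
    exact Real.rpow_le_rpow_of_exponent_le (by linarith [(Nat.cast_nonneg (n + 1) : (0 : ℝ) ≤ _)])
      (by linarith)
  refine h3.trans ?_
  have h5 : riemannZeta 2 = ((Real.pi ^ 2 / 6 : ℝ) : ℂ) := by rw [riemannZeta_two]; push_cast; rfl
  rw [h5, ofReal_re]
  nlinarith [Real.pi_lt_d2, Real.pi_pos]

lemma norm_zeta₁_bounds {s : ℂ} (hs : 2 ≤ s.re) :
    ‖s - 1‖ / 3 ≤ ‖riemannZeta₁ s‖ ∧ ‖riemannZeta₁ s‖ ≤ 2 * ‖s - 1‖ := by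
  have h1 : s ≠ 1 := fun h => by rw [h, one_re] at hs; linarith
  have h := norm_zeta_sub_one_le hs
  rw [zeta₁_eq_sub_one_mul h1, norm_mul]
  have h2 : 1 / 3 ≤ ‖riemannZeta s‖ := by
    have := norm_sub_norm_le (1 : ℂ) (riemannZeta s)
    rw [norm_sub_rev, norm_one] at this
    linarith
  have h3 : ‖riemannZeta s‖ ≤ 2 := by
    have := norm_sub_norm_le (riemannZeta s) 1
    rw [norm_one] at this
    linarith
  constructor <;> nlinarith [norm_nonneg (s - 1)]

lemma one_le_log_seven_add_abs (t : ℝ) : 1 ≤ Real.log (7 + |t|) := by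
  rw [Real.le_log_iff_exp_le (by positivity)]
  have := Real.exp_one_lt_d9
  linarith [abs_nonneg t]

lemma exists_zeta₁_log (hRH : RiemannHypothesis) : ∃ K : ℝ, 0 < K ∧ ∀ t : ℝ, ∃ L : ℂ → ℂ,
    DifferentiableOn ℂ L (Metric.ball (3 + t * I) (5 / 2)) ∧
    (∀ z ∈ Metric.ball (3 + t * I : ℂ) (5 / 2),
      riemannZeta₁ z = riemannZeta₁ (3 + t * I) * cexp (L z)) ∧
    ∀ z ∈ Metric.ball (3 + t * I : ℂ) (5 / 2), ‖L z‖ ≤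
      2 * (K * Real.log (7 + |t|)) * ‖z - (3 + t * I)‖ / (5 / 2 - ‖z - (3 + t * I)‖) := by
  obtain ⟨C, hC, hCle⟩ := exists_norm_zeta₁_le (a := 1 / 2) (by norm_num)
  refine ⟨2 + Real.log (2 * C), ?_, fun t => ?_⟩
  · have := Real.log_nonneg (x := 2 * C) (by linarith)
    linarith
  have hlog := one_le_log_seven_add_abs t
  have hlogC := Real.log_nonneg (x := 2 * C) (by linarith)
  have hre : ∀ z ∈ Metric.ball (3 + t * I : ℂ) (5 / 2), 1 / 2 < z.re := by
    intro z hz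
    rw [mem_ball_iff_norm] at hz
    have := (abs_re_le_norm _).trans_lt hz
    simp only [sub_re, add_re, re_ofNat, mul_re, ofReal_re, I_re, mul_zero, ofReal_im, I_im,
      zero_mul, sub_zero, add_zero] at this
    linarith [(abs_lt.1 this).1]
  refine exists_log_of_ne_zero (by norm_num) (by nlinarith)
    differentiable_riemannZeta₁.differentiableOn (fun z hz => zeta₁_ne_zero hRH (hre z hz))
    fun z hz => ?_
  have h1 := hCle z (hre z hz).le
  have h2 : ‖z‖ ≤ 6 + |t| := by
    rw [mem_ball_iff_norm] at hz
    have e : z = (z - (3 + t * I)) + (3 + t * I) := by ring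
    rw [e]
    refine (norm_add_le _ _).trans ?_
    have : ‖(3 : ℂ) + t * I‖ ≤ 3 + |t| := by
      refine (norm_add_le _ _).trans ?_
      rw [norm_mul, norm_I, norm_real, Real.norm_eq_abs, mul_one]
      norm_num
    linarith
  have h3 : 2 / 3 ≤ ‖riemannZeta₁ (3 + t * I)‖ := by
    have h4 := (norm_zeta₁_bounds (s := 3 + t * I) (by simp; norm_num)).1
    have h5 := abs_re_le_norm ((3 : ℂ) + t * I - 1)
    simp only [sub_re, add_re, re_ofNat, mul_re, ofReal_re, I_re, mul_zero, ofReal_im, I_im,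
      zero_mul, sub_zero, add_zero, one_re] at h5
    norm_num at h5
    linarith
  have h4 : 2 * C * (7 + |t|) ^ 2 ≤ Real.exp ((2 + Real.log (2 * C)) * Real.log (7 + |t|)) := by
    have h5 : 2 * C * (7 + |t|) ^ 2 = Real.exp (Real.log (2 * C) + 2 * Real.log (7 + |t|)) := by
      rw [Real.exp_add, Real.exp_log (by linarith), mul_comm 2 (Real.log _),
        Real.exp_mul, Real.exp_log (by positivity)]
      norm_num
    rw [h5]
    refine Real.exp_le_exp.2 ?_
    nlinarith
  have h6 : 0 ≤ Real.exp ((2 + Real.log (2 * C)) * Real.log (7 + |t|)) := (Real.exp_pos _).le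
  have h7 : C * (1 + ‖z‖) ^ 2 ≤ C * (7 + |t|) ^ 2 :=
    mul_le_mul_of_nonneg_left (pow_le_pow_left₀ (by positivity) (by linarith) 2) (by linarith)
  nlinarith

lemma exists_norm_inv_zeta₁_le (hRH : RiemannHypothesis) {δ : ℝ} (hδ : 0 < δ) :
    ∃ A : ℝ, 0 ≤ A ∧ ∀ s : ℂ, 1 / 2 + δ ≤ s.re → s.re ≤ 3 →
      ‖(riemannZeta₁ s)⁻¹‖ ≤ 2 * (7 + |s.im|) ^ A := by
  obtain ⟨K, hK, h⟩ := exists_zeta₁_log hRH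
  refine ⟨5 * K / δ, by positivity, fun s hs1 hs2 => ?_⟩
  obtain ⟨L, -, hL, hLle⟩ := h s.im
  have hlog := one_le_log_seven_add_abs s.im
  have hsc : ‖s - (3 + s.im * I)‖ = 3 - s.re := by
    have : s - (3 + s.im * I) = ((s.re - 3 : ℝ) : ℂ) := by
      apply Complex.ext <;> simp
    rw [this, norm_real, Real.norm_eq_abs, abs_of_nonpos (by linarith)]
    ring
  have hmem : s ∈ Metric.ball (3 + s.im * I : ℂ) (5 / 2) := by
    rw [mem_ball_iff_norm, hsc]; linarith
  have h1 : ‖L s‖ ≤ 5 * K / δ * Real.log (7 + |s.im|) := by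
    refine (hLle s hmem).trans ?_
    rw [hsc, div_mul_eq_mul_div, div_le_div_iff₀ (by linarith) hδ]
    have : 0 ≤ K * Real.log (7 + |s.im|) := by positivity
    calc _ = 2 * (K * Real.log (7 + |s.im|)) * ((3 - s.re) * δ) := by ring
      _ ≤ 2 * (K * Real.log (7 + |s.im|)) * (5 / 2 * (5 / 2 - (3 - s.re))) := by
        gcongr <;> linarith
      _ = _ := by ring
  have h3 : 2 / 3 ≤ ‖riemannZeta₁ (3 + s.im * I)‖ := by
    have h4 := (norm_zeta₁_bounds (s := 3 + s.im * I) (by simp; norm_num)).1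
    have h5 := abs_re_le_norm ((3 : ℂ) + s.im * I - 1)
    simp only [sub_re, add_re, re_ofNat, mul_re, ofReal_re, I_re, mul_zero, ofReal_im, I_im,
      zero_mul, sub_zero, add_zero, one_re] at h5
    norm_num at h5
    linarith
  rw [hL s hmem, mul_inv, ← Complex.exp_neg, norm_mul, norm_inv, norm_exp,
    Real.rpow_def_of_pos (by positivity)]
  gcongr
  · rw [inv_le_comm₀ (by linarith) (by norm_num)]
    linarith
  · rw [mul_comm (Real.log _)]
    refine le_trans ?_ h1
    rw [← norm_neg]
    exact (le_abs_self _).trans (abs_re_le_norm _)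

lemma exists_norm_zeta₁_div_le (hRH : RiemannHypothesis) {δ : ℝ} (hδ : 0 < δ) :
    ∃ A : ℝ, 0 ≤ A ∧ ∀ s b : ℂ, 1 / 2 + 3 * δ ≤ s.re → s.re ≤ 3 → ‖s - b‖ ≤ δ →
      ‖riemannZeta₁ s / riemannZeta₁ b‖ ≤ (7 + |s.im|) ^ (A * ‖s - b‖) := by
  obtain ⟨K, hK, h⟩ := exists_zeta₁_log hRH
  refine ⟨2 * K * (5 / 2) / δ / δ, by positivity, fun s b hs1 hs2 hb => ?_⟩
  obtain ⟨L, hLd, hL, hLle⟩ := h s.im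
  have hlog := one_le_log_seven_add_abs s.im
  have hsc : ‖s - (3 + s.im * I)‖ = 3 - s.re := by
    have : s - (3 + s.im * I) = ((s.re - 3 : ℝ) : ℂ) := by
      apply Complex.ext <;> simp
    rw [this, norm_real, Real.norm_eq_abs, abs_of_nonpos (by linarith)]
    ring
  have hbc : ‖b - (3 + s.im * I)‖ ≤ 5 / 2 - 2 * δ := by
    have e : b - (3 + s.im * I) = (s - (3 + s.im * I)) - (s - b) := by ring
    rw [e]
    refine (norm_sub_le _ _).trans ?_
    rw [hsc]; linarith
  have := norm_div_le_exp_of_log (f := riemannZeta₁) (by positivity) hδ hLd hL hLle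
    (zeta₁_ne_zero hRH (by simp; norm_num)) (a := s) (b := b) (by rw [hsc]; linarith) hbc
  refine this.trans (le_of_eq ?_)
  rw [Real.rpow_def_of_pos (by positivity)]
  congr 1
  ring

lemma norm_GammaSeq (s : ℂ) {n : ℕ} (hn : 0 < n) : ‖GammaSeq s n‖ =
    (n : ℝ) ^ s.re * n.factorial * (∏ j ∈ Finset.range (n + 1), ‖s + j‖)⁻¹ := by
  rw [GammaSeq, norm_div, norm_mul, norm_natCast_cpow_of_pos hn, norm_natCast, norm_prod,
    div_eq_mul_inv]

lemma re_add_natCast_le_norm (s : ℂ) (j : ℕ) : s.re + j ≤ ‖s + j‖ := by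
  simpa using re_le_norm (s + j)

lemma norm_Gamma_sq_le_mul : ∃ C : ℝ, 0 < C ∧ ∀ z : ℂ, 0 < z.re →
    ‖Gamma (z + 1 / 3)‖ ^ 2 ≤ C * (‖Gamma z‖ * ‖Gamma (z + 1 / 3 + 1 / 3)‖) := by
  have hs := summable_nat_add_one_rpow (p := -2) (by norm_num)
  refine ⟨Real.exp (∑' j : ℕ, ((j : ℝ) + 1) ^ (-2 : ℝ)), Real.exp_pos _, fun z hz => ?_⟩
  refine le_of_tendsto_of_tendsto ((GammaSeq_tendsto_Gamma _).norm.pow 2)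
    (((GammaSeq_tendsto_Gamma _).norm.mul (GammaSeq_tendsto_Gamma _).norm).const_mul _) ?_
  filter_upwards [Filter.eventually_gt_atTop 0] with n hn
  simp only [norm_GammaSeq _ hn]
  have hn' : (0 : ℝ) < n := by exact_mod_cast hn
  have hpos : ∀ (s : ℂ), 0 < s.re → ∀ j : ℕ, 0 < ‖s + j‖ := fun s hs j =>
    lt_of_lt_of_le (by positivity) (re_add_natCast_le_norm s j)
  have hz1 : 0 < (z + 1 / 3).re := by simp; linarith
  have hz2 : 0 < (z + 1 / 3 + 1 / 3).re := by simp; linarith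
  have hP : (∏ j ∈ Finset.range (n + 1), ‖z + j‖) *
      (∏ j ∈ Finset.range (n + 1), ‖z + 1 / 3 + 1 / 3 + j‖) ≤
      Real.exp (∑' j : ℕ, ((j : ℝ) + 1) ^ (-2 : ℝ)) *
        (∏ j ∈ Finset.range (n + 1), ‖z + 1 / 3 + j‖) ^ 2 := by
    rw [← Finset.prod_mul_distrib, ← Finset.prod_pow]
    calc _ ≤ ∏ j ∈ Finset.range (n + 1),
          Real.exp (((j : ℝ) + 1) ^ (-2 : ℝ)) * ‖z + 1 / 3 + j‖ ^ 2 := by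
          refine Finset.prod_le_prod (fun j _ => by positivity) fun j _ => ?_
          have e : ‖z + j‖ * ‖z + 1 / 3 + 1 / 3 + j‖ ≤ ‖z + 1 / 3 + j‖ ^ 2 + 1 / 9 := by
            rw [← norm_mul]
            have e1 : (z + j) * (z + 1 / 3 + 1 / 3 + j) = (z + 1 / 3 + j) ^ 2 - 1 / 9 := by ring
            rw [e1]
            refine (norm_sub_le _ _).trans ?_
            rw [norm_pow]
            norm_num
          have e2 := re_add_natCast_le_norm (z + 1 / 3) j
          have e3 : (1 / 3 : ℝ) + j ≤ ‖z + 1 / 3 + j‖ := by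
            refine le_trans ?_ e2
            simp; linarith
          have e4 : 1 / 9 ≤ ((j : ℝ) + 1) ^ (-2 : ℝ) * ‖z + 1 / 3 + j‖ ^ 2 := by
            rw [Real.rpow_neg (by positivity), Real.rpow_two, ← div_eq_inv_mul,
              le_div_iff₀ (by positivity)]
            nlinarith [(Nat.cast_nonneg j : (0 : ℝ) ≤ j)]
          have e5 := Real.add_one_le_exp (((j : ℝ) + 1) ^ (-2 : ℝ))
          nlinarith [sq_nonneg ‖z + 1 / 3 + j‖]
      _ ≤ _ := by
        rw [Finset.prod_mul_distrib, ← Real.exp_sum]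
        gcongr
        exact hs.sum_le_tsum _ (fun j _ => by positivity)
  have hp : ∀ s : ℂ, 0 < s.re → 0 < ∏ j ∈ Finset.range (n + 1), ‖s + j‖ := fun s hs =>
    Finset.prod_pos fun j _ => hpos s hs j
  have h0 := hp z hz
  have h1 := hp _ hz1
  have h2 := hp _ hz2
  have hr : (n : ℝ) ^ z.re * (n : ℝ) ^ (z + 1 / 3 + 1 / 3).re = ((n : ℝ) ^ (z + 1 / 3).re) ^ 2 := by
    rw [← Real.rpow_add hn', ← Real.rpow_two, ← Real.rpow_mul hn'.le]
    congr 1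
    simp; ring
  set P0 := ∏ j ∈ Finset.range (n + 1), ‖z + j‖
  set P1 := ∏ j ∈ Finset.range (n + 1), ‖z + 1 / 3 + j‖
  set P2 := ∏ j ∈ Finset.range (n + 1), ‖z + 1 / 3 + 1 / 3 + j‖
  set E := Real.exp (∑' j : ℕ, ((j : ℝ) + 1) ^ (-2 : ℝ))
  have hinv : (P1 ^ 2)⁻¹ ≤ E * (P0 * P2)⁻¹ := by
    rw [← div_eq_mul_inv, le_div_iff₀ (by positivity), ← div_eq_inv_mul,
      div_le_iff₀ (by positivity)]
    exact hP
  calc _ = (((n : ℝ) ^ (z + 1 / 3).re) ^ 2 * (n.factorial : ℝ) ^ 2) * (P1 ^ 2)⁻¹ := by ring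
    _ ≤ (((n : ℝ) ^ (z + 1 / 3).re) ^ 2 * (n.factorial : ℝ) ^ 2) * (E * (P0 * P2)⁻¹) := by gcongr
    _ = _ := by rw [← hr, mul_inv]; ring

lemma norm_Gamma_mul_Gamma_le {a b : ℝ} (ha : 0 < a) (hab : a ≤ b) (y : ℝ) :
    ‖Gamma (a + y * I)‖ * ‖Gamma b‖ ≤ ‖Gamma a‖ * ‖Gamma (b + y * I)‖ := by
  refine le_of_tendsto_of_tendsto
    ((GammaSeq_tendsto_Gamma _).norm.mul (GammaSeq_tendsto_Gamma _).norm)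
    ((GammaSeq_tendsto_Gamma _).norm.mul (GammaSeq_tendsto_Gamma _).norm) ?_
  filter_upwards [Filter.eventually_gt_atTop 0] with n hn
  simp only [norm_GammaSeq _ hn]
  have hpos : ∀ (s : ℂ), 0 < s.re → ∀ j : ℕ, 0 < ‖s + j‖ := fun s hs j =>
    lt_of_lt_of_le (by positivity) (re_add_natCast_le_norm s j)
  have hp : ∀ s : ℂ, 0 < s.re → 0 < ∏ j ∈ Finset.range (n + 1), ‖s + j‖ := fun s hs =>
    Finset.prod_pos fun j _ => hpos s hs j
  have hb : 0 < b := ha.trans_le hab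
  have h0 := hp (a + y * I) (by simpa using ha)
  have h1 := hp b (by simpa using hb)
  have h2 := hp a (by simpa using ha)
  have h3 := hp (b + y * I) (by simpa using hb)
  have hP : (∏ j ∈ Finset.range (n + 1), ‖(a : ℂ) + j‖) *
      (∏ j ∈ Finset.range (n + 1), ‖(b + y * I : ℂ) + j‖) ≤
      (∏ j ∈ Finset.range (n + 1), ‖(a + y * I : ℂ) + j‖) *
      (∏ j ∈ Finset.range (n + 1), ‖(b : ℂ) + j‖) := by
    rw [← Finset.prod_mul_distrib, ← Finset.prod_mul_distrib]
    refine Finset.prod_le_prod (fun j _ => by positivity) fun j _ => ?_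
    have e1 : ∀ x : ℝ, (x + y * I : ℂ) + j = ((x + j : ℝ) : ℂ) + y * I := fun x => by
      push_cast; ring
    have e2 : ∀ x : ℝ, 0 < x → ‖(x : ℂ) + j‖ = x + j := fun x hx => by
      rw [← ofReal_natCast, ← ofReal_add, norm_real, Real.norm_of_nonneg (by positivity)]
    rw [e1, e1, e2 a ha, e2 b hb, norm_add_mul_I, norm_add_mul_I]
    refine le_of_sq_le_sq ?_ (by positivity)
    rw [mul_pow, mul_pow, Real.sq_sqrt (by positivity), Real.sq_sqrt (by positivity)]
    have : (a + j) ^ 2 ≤ (b + j) ^ 2 := by gcongr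
    nlinarith [sq_nonneg y]
  have hinv : (∏ j ∈ Finset.range (n + 1), ‖(a + y * I : ℂ) + j‖)⁻¹ *
      (∏ j ∈ Finset.range (n + 1), ‖(b : ℂ) + j‖)⁻¹ ≤
      (∏ j ∈ Finset.range (n + 1), ‖(a : ℂ) + j‖)⁻¹ *
      (∏ j ∈ Finset.range (n + 1), ‖(b + y * I : ℂ) + j‖)⁻¹ := by
    rw [← mul_inv, ← mul_inv]
    exact inv_anti₀ (by positivity) hP
  have ea : (a + y * I : ℂ).re = a := by simp
  have eb : (b + y * I : ℂ).re = b := by simp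
  rw [ea, eb, ofReal_re, ofReal_re]
  have hle := mul_le_mul_of_nonneg_left hinv
    (show 0 ≤ (n : ℝ) ^ a * n.factorial * ((n : ℝ) ^ b * n.factorial) by positivity)
  exact (mul_mul_mul_comm _ _ _ _).le.trans (hle.trans (mul_mul_mul_comm _ _ _ _).le)

lemma exists_norm_Gamma_add_pow_le : ∃ C : ℝ, 0 < C ∧ ∀ (z : ℂ) (δ : ℝ), 1 / 12 ≤ z.re →
    z.re ≤ 1 / 4 → 0 ≤ δ → δ ≤ 1 / 3 → ‖Gamma (z + δ)‖ ^ 3 ≤ C * ‖z‖ * ‖Gamma z‖ ^ 3 := by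
  obtain ⟨C, hC, h⟩ := norm_Gamma_sq_le_mul
  have hcont : ContinuousOn Real.Gamma (Set.Icc (1 / 12) 1) := fun x hx =>
    (Real.differentiableAt_Gamma fun m => by
      have : (0 : ℝ) ≤ m := Nat.cast_nonneg m
      linarith [hx.1]).continuousAt.continuousWithinAt
  have hne : (Set.Icc (1 / 12 : ℝ) 1).Nonempty := ⟨1, by norm_num⟩
  obtain ⟨p, hp, hpmin⟩ := isCompact_Icc.exists_isMinOn hne hcont
  obtain ⟨q, hq, hqmax⟩ := isCompact_Icc.exists_isMaxOn hne hcont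
  have hp0 : 0 < Real.Gamma p := Real.Gamma_pos_of_pos (by linarith [hp.1])
  have hq0 : 0 < Real.Gamma q := Real.Gamma_pos_of_pos (by linarith [hq.1])
  refine ⟨(Real.Gamma q / Real.Gamma p) ^ 3 * C ^ 3, by positivity,
    fun z δ hz1 hz2 hδ1 hδ2 => ?_⟩
  have hz0 : z ≠ 0 := fun h => by rw [h, zero_re] at hz1; linarith
  have hre3 : (z + 1 / 3).re = z.re + 1 / 3 := by simp
  have hb : ‖Gamma (z + 1 / 3)‖ ^ 3 ≤ C ^ 3 * (‖z‖ * ‖Gamma z‖ ^ 3) := by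
    have i1 := h z (by linarith)
    have i2 := h (z + 1 / 3) (by rw [hre3]; linarith)
    have e : z + 1 / 3 + 1 / 3 + 1 / 3 = z + 1 := by ring
    rw [e, Gamma_add_one z hz0, norm_mul] at i2
    have hbpos : 0 < ‖Gamma (z + 1 / 3)‖ :=
      norm_pos_iff.2 (Gamma_ne_zero_of_re_pos (by rw [hre3]; linarith))
    set a := ‖Gamma z‖
    set b := ‖Gamma (z + 1 / 3)‖
    set c := ‖Gamma (z + 1 / 3 + 1 / 3)‖
    have i3 : b ^ 3 * b ≤ (C ^ 3 * (‖z‖ * a ^ 3)) * b := by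
      calc b ^ 3 * b = (b ^ 2) ^ 2 := by ring
        _ ≤ (C * (a * c)) ^ 2 := by gcongr
        _ = C ^ 2 * a ^ 2 * c ^ 2 := by ring
        _ ≤ C ^ 2 * a ^ 2 * (C * (b * (‖z‖ * a))) := by gcongr
        _ = _ := by ring
    exact le_of_mul_le_mul_right i3 hbpos
  have hmono := norm_Gamma_mul_Gamma_le (a := z.re + δ) (b := z.re + 1 / 3) (by linarith)
    (by linarith) z.im
  have e1 : ((z.re + δ : ℝ) : ℂ) + z.im * I = z + δ := by
    conv_rhs => rw [← re_add_im z]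
    push_cast; ring
  have e2 : ((z.re + 1 / 3 : ℝ) : ℂ) + z.im * I = z + 1 / 3 := by
    conv_rhs => rw [← re_add_im z]
    push_cast; ring
  rw [e1, e2, Gamma_ofReal, Gamma_ofReal, norm_real, norm_real,
    Real.norm_of_nonneg (Real.Gamma_nonneg_of_nonneg (by linarith)),
    Real.norm_of_nonneg (Real.Gamma_nonneg_of_nonneg (by linarith))] at hmono
  have h1 : Real.Gamma p ≤ Real.Gamma (z.re + 1 / 3) := hpmin ⟨by linarith, by linarith⟩
  have h2 : Real.Gamma (z.re + δ) ≤ Real.Gamma q := hqmax ⟨by linarith, by linarith⟩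
  have h3 : ‖Gamma (z + δ)‖ ≤ Real.Gamma q / Real.Gamma p * ‖Gamma (z + 1 / 3)‖ := by
    rw [div_mul_eq_mul_div, le_div_iff₀ hp0]
    calc _ ≤ ‖Gamma (z + δ)‖ * Real.Gamma (z.re + 1 / 3) := by gcongr
      _ ≤ _ := hmono
      _ ≤ _ := by gcongr
  calc _ ≤ (Real.Gamma q / Real.Gamma p * ‖Gamma (z + 1 / 3)‖) ^ 3 := by gcongr
    _ = (Real.Gamma q / Real.Gamma p) ^ 3 * ‖Gamma (z + 1 / 3)‖ ^ 3 := by ring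
    _ ≤ (Real.Gamma q / Real.Gamma p) ^ 3 * (C ^ 3 * (‖z‖ * ‖Gamma z‖ ^ 3)) := by gcongr
    _ = _ := by ring

lemma norm_Gammaℝ (s : ℂ) : ‖Gammaℝ s‖ = Real.pi ^ (-s.re / 2) * ‖Gamma (s / 2)‖ := by
  rw [Gammaℝ_def, norm_mul, norm_cpow_eq_rpow_re_of_pos Real.pi_pos]
  congr 2
  rw [show (-s / 2 : ℂ) = ((-1 / 2 : ℝ) : ℂ) * s by push_cast; ring, re_ofReal_mul]
  ring

lemma norm_zeta_mul_norm_Gammaℝ {w : ℂ} {ε : ℝ} (hε1 : ε ≤ 2 / 3) (hε0 : 0 < ε)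
    (hw : w.re = 1 / 2 - ε / 2) :
    ‖riemannZeta w‖ * ‖Gammaℝ w‖ = ‖riemannZeta (w + ε)‖ * ‖Gammaℝ (w + ε)‖ := by
  have hre : 0 < w.re := by rw [hw]; linarith
  have hw0 : (starRingEnd ℂ) w ≠ 0 := fun h => by
    have := congrArg re h
    simp at this
    linarith
  have hwε : w + ε ≠ 0 := fun h => by
    have := congrArg re h
    simp at this
    linarith
  have hG : ‖Gammaℝ ((starRingEnd ℂ) w)‖ = ‖Gammaℝ w‖ := by
    rw [norm_Gammaℝ, norm_Gammaℝ, conj_re]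
    congr 1
    rw [show (starRingEnd ℂ) w / 2 = (starRingEnd ℂ) (w / 2) by rw [map_div₀, conj_ofNat], Gamma_conj, norm_conj]
  have hG0 : Gammaℝ ((starRingEnd ℂ) w) ≠ 0 := Gammaℝ_ne_zero_of_re_pos (by simpa using hre)
  have hG1 : Gammaℝ (w + ε) ≠ 0 := Gammaℝ_ne_zero_of_re_pos (by simp; linarith)
  have e : 1 - (w + ε) = (starRingEnd ℂ) w := by
    apply Complex.ext
    · simp; linarith
    · simp
  have hL := completedRiemannZeta_one_sub (w + ε)
  rw [e] at hL
  have h1 : riemannZeta ((starRingEnd ℂ) w) * Gammaℝ ((starRingEnd ℂ) w) =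
      riemannZeta (w + ε) * Gammaℝ (w + ε) := by
    rw [riemannZeta_def_of_ne_zero hw0, riemannZeta_def_of_ne_zero hwε, div_mul_cancel₀ _ hG0,
      div_mul_cancel₀ _ hG1, hL]
  have h2 := congrArg norm h1
  rwa [norm_mul, norm_mul, hG, riemannZeta_conj, norm_conj] at h2

lemma exists_norm_zeta₁_pow_le : ∃ C : ℝ, 0 < C ∧ ∀ (ε : ℝ) (w : ℂ), 0 < ε → ε ≤ 2 / 3 →
    w.re = 1 / 2 - ε / 2 → ‖riemannZeta₁ w‖ ^ 3 ≤ C * ‖w‖ * ‖riemannZeta₁ (w + ε)‖ ^ 3 := by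
  obtain ⟨C, hC, h⟩ := exists_norm_Gamma_add_pow_le
  refine ⟨7 ^ 3 * C, by positivity, fun ε w hε0 hε1 hw => ?_⟩
  have hre : 1 / 6 ≤ w.re := by rw [hw]; linarith
  have hdiv : (w / 2).re = w.re / 2 := by simp
  have hΓ : ‖Gammaℝ (w + ε)‖ ^ 3 ≤ C * ‖w‖ * ‖Gammaℝ w‖ ^ 3 := by
    have h1 := h (w / 2) (ε / 2) (by linarith) (by linarith) (by linarith) (by linarith)
    rw [norm_Gammaℝ, norm_Gammaℝ, mul_pow, mul_pow]
    have e : (w + ε) / 2 = w / 2 + ((ε / 2 : ℝ) : ℂ) := by push_cast; ring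
    rw [e]
    have h2 : Real.pi ^ (-(w + ε).re / 2) ≤ Real.pi ^ (-w.re / 2) :=
      Real.rpow_le_rpow_of_exponent_le (by linarith [Real.pi_gt_three]) (by simp; linarith)
    calc _ ≤ (Real.pi ^ (-w.re / 2)) ^ 3 * (C * ‖w / 2‖ * ‖Gamma (w / 2)‖ ^ 3) := by gcongr
      _ ≤ (Real.pi ^ (-w.re / 2)) ^ 3 * (C * ‖w‖ * ‖Gamma (w / 2)‖ ^ 3) := by
        gcongr
        rw [norm_div, norm_ofNat]
        linarith [norm_nonneg w]
      _ = _ := by ring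
  have hΓ0 : 0 < ‖Gammaℝ w‖ := norm_pos_iff.2 (Gammaℝ_ne_zero_of_re_pos (by linarith))
  have hζ : ‖riemannZeta w‖ ^ 3 ≤ C * ‖w‖ * ‖riemannZeta (w + ε)‖ ^ 3 := by
    refine le_of_mul_le_mul_right ?_ (pow_pos hΓ0 3)
    rw [← mul_pow, norm_zeta_mul_norm_Gammaℝ hε1 hε0 hw, mul_pow]
    calc _ ≤ ‖riemannZeta (w + ε)‖ ^ 3 * (C * ‖w‖ * ‖Gammaℝ w‖ ^ 3) := by gcongr
      _ = _ := by ring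
  have hw1 : w ≠ 1 := fun h => by rw [h, one_re] at hw; linarith
  have hw2 : w + ε ≠ 1 := fun h => by
    have := congrArg re h
    simp at this
    linarith
  rw [zeta₁_eq_sub_one_mul hw1, zeta₁_eq_sub_one_mul hw2, norm_mul, norm_mul, mul_pow, mul_pow]
  have h7 : ‖w - 1‖ ≤ 7 * ‖w + ε - 1‖ := by
    have h1 : 1 / 6 ≤ ‖w + ε - 1‖ := by
      have := (abs_re_le_norm (w + ε - 1))
      refine le_trans ?_ this
      rw [le_abs]
      right
      simp
      linarith
    have h2 : ‖w - 1‖ ≤ ‖w + ε - 1‖ + ‖(ε : ℂ)‖ := by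
      have := norm_sub_le (w + ε - 1) (ε : ℂ)
      rwa [show w + ε - 1 - ε = w - 1 by ring] at this
    rw [norm_real, Real.norm_of_nonneg hε0.le] at h2
    linarith
  calc _ ≤ (7 * ‖w + ε - 1‖) ^ 3 * (C * ‖w‖ * ‖riemannZeta (w + ε)‖ ^ 3) := by gcongr
    _ = _ := by ring

lemma exists_norm_zeta₁_div_pow_le (hRH : RiemannHypothesis) : ∃ C : ℝ, 0 < C ∧
    ∀ (ε : ℝ) (w : ℂ), 0 < ε → ε ≤ 2 / 3 → w.re = 1 / 2 →
      ‖riemannZeta₁ w / riemannZeta₁ (w + ε)‖ ^ 3 ≤ C * ‖w + 2‖ := by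
  obtain ⟨C₁, hC₁, hleft⟩ := exists_norm_zeta₁_pow_le
  refine ⟨C₁ + 216, by positivity, fun ε w hε0 hε1 hw => ?_⟩
  set f : ℂ → ℂ := fun w => (riemannZeta₁ w / riemannZeta₁ (w + ε)) ^ 3 / (w + 2) with hf
  have hne : ∀ z : ℂ, 1 / 2 - ε / 2 ≤ z.re → riemannZeta₁ (z + ε) ≠ 0 := fun z hz =>
    zeta₁_ne_zero hRH (by simp; linarith)
  have hone : ∀ z : ℂ, 1 / 2 - ε / 2 ≤ z.re → 1 ≤ ‖z + 2‖ := fun z hz => by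
    refine le_trans ?_ (re_le_norm _)
    simp
    linarith
  have hdiff : ∀ z : ℂ, 1 / 2 - ε / 2 ≤ z.re → DifferentiableAt ℂ f z := fun z hz => by
    refine (((differentiable_riemannZeta₁ z).div ?_ (hne z hz)).pow 3).div (by fun_prop)
      (norm_pos_iff.1 (one_pos.trans_le (hone z hz)))
    exact (differentiable_riemannZeta₁.comp (differentiable_id.add_const (ε : ℂ))) z
  have hbound : ‖f w‖ ≤ C₁ + 216 := by
    refine PhragmenLindelof.vertical_strip (a := 1 / 2 - ε / 2) (b := 2) ⟨?_, ?_⟩ ?_ ?_ ?_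
      (by linarith) (by linarith)
    · exact fun z hz => (hdiff z hz.1.le).differentiableWithinAt
    · rw [closure_preimage_re, closure_Ioo (by linarith)]
      exact fun z hz => (hdiff z hz.1).continuousAt.continuousWithinAt
    · obtain ⟨K, hK, hZ⟩ := exists_norm_zeta₁_le (a := 1 / 6) (by norm_num)
      obtain ⟨A, hA, hinv⟩ := exists_norm_inv_zeta₁_le hRH (δ := ε / 2) (by linarith)
      refine ⟨1, ?_, 6 * (3 * (2 + A)), Asymptotics.IsBigO.of_bound ((2 * K) ^ 3) ?_⟩
      · rw [lt_div_iff₀ (by linarith)]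
        linarith [Real.pi_gt_three]
      · filter_upwards [Filter.mem_inf_of_right (Filter.mem_principal_self _)] with z hz
        have hz1 : 1 / 2 - ε / 2 < z.re := hz.1
        have hz2 : z.re < 2 := hz.2
        have h1 := hZ z (by linarith)
        have h2 := hinv (z + ε) (by simp; linarith) (by simp; linarith)
        have him : (z + ε).im = z.im := by simp
        rw [him] at h2
        have hnz : 1 + ‖z‖ ≤ 7 + |z.im| := by
          have := norm_le_abs_re_add_abs_im z
          rw [abs_of_nonneg (by linarith : 0 ≤ z.re)] at this
          linarith
        have h7 : 0 < 7 + |z.im| := by positivity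
        rw [Real.norm_of_nonneg (Real.exp_pos _).le]
        have hexp : (7 + |z.im|) ^ (3 * (2 + A)) ≤
            Real.exp (6 * (3 * (2 + A)) * Real.exp (1 * |z.im|)) := by
          rw [Real.rpow_def_of_pos h7]
          refine Real.exp_le_exp.2 ?_
          have e1 := Real.log_le_sub_one_of_pos h7
          have e2 := Real.add_one_le_exp |z.im|
          have e3 : Real.log (7 + |z.im|) ≤ 6 * Real.exp (1 * |z.im|) := by
            rw [one_mul]; linarith [abs_nonneg z.im]
          calc _ ≤ 6 * Real.exp (1 * |z.im|) * (3 * (2 + A)) := by gcongr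
            _ = _ := by ring
        calc ‖f z‖ ≤ ‖(riemannZeta₁ z / riemannZeta₁ (z + ε)) ^ 3‖ := by
              rw [hf, norm_div]
              exact div_le_self (norm_nonneg _) (hone z hz1.le)
          _ = (‖riemannZeta₁ z‖ * ‖(riemannZeta₁ (z + ε))⁻¹‖) ^ 3 := by
              rw [norm_pow, div_eq_mul_inv, norm_mul]
          _ ≤ ((K * (7 + |z.im|) ^ 2) * (2 * (7 + |z.im|) ^ A)) ^ 3 := by
              gcongr
              exact h1.trans (by gcongr)
          _ = (2 * K) ^ 3 * (7 + |z.im|) ^ (3 * (2 + A)) := by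
              rw [mul_comm 3 (2 + A), Real.rpow_mul h7.le, Real.rpow_add h7]
              norm_cast
              ring
          _ ≤ _ := by gcongr
    · intro z hz
      have h1 := hleft ε z hε0 hε1 hz
      have h2 : 0 < ‖riemannZeta₁ (z + ε)‖ := norm_pos_iff.2 (hne z hz.ge)
      have h3 : ‖z‖ ≤ ‖z + 2‖ := by
        rw [norm_def, norm_def]
        refine Real.sqrt_le_sqrt ?_
        simp only [normSq_apply, add_re, add_im, re_ofNat, im_ofNat]
        nlinarith
      rw [hf]
      simp only [norm_div, norm_pow]
      rw [div_pow, div_div, div_le_iff₀ (by have := hone z hz.ge; positivity)]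
      calc _ ≤ C₁ * ‖z‖ * ‖riemannZeta₁ (z + ε)‖ ^ 3 := h1
        _ ≤ (C₁ + 216) * ‖z + 2‖ * ‖riemannZeta₁ (z + ε)‖ ^ 3 := by
          gcongr
          linarith
        _ = _ := by ring
    · intro z hz
      have hz' : 1 / 2 - ε / 2 ≤ z.re := by rw [hz]; linarith
      have h1 := (norm_zeta₁_bounds hz.ge).2
      have h2 := (norm_zeta₁_bounds (s := z + ε) (by simp; linarith)).1
      have h3 : ‖z - 1‖ ≤ ‖z + ε - 1‖ := by
        rw [norm_def, norm_def]
        refine Real.sqrt_le_sqrt ?_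
        simp [normSq_apply, hz]
        nlinarith
      have h4 : 0 < ‖riemannZeta₁ (z + ε)‖ := norm_pos_iff.2 (hne z hz')
      have h5 : ‖riemannZeta₁ z / riemannZeta₁ (z + ε)‖ ≤ 6 := by
        rw [norm_div, div_le_iff₀ h4]
        linarith
      rw [hf]
      simp only [norm_div _ (z + 2), norm_pow]
      refine (div_le_self (by positivity) (hone z hz')).trans ?_
      have := pow_le_pow_left₀ (norm_nonneg _) h5 3
      linarith
  have h2 : 0 < ‖w + 2‖ := one_pos.trans_le (hone w (by linarith))
  rwa [hf, norm_div, norm_pow, div_le_iff₀ h2] at hbound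

lemma hasSum_inv_zeta {s : ℂ} (hs : 1 < s.re) :
    HasSum (fun n : ℕ => (ArithmeticFunction.moebius n : ℂ) * (n : ℂ) ^ (-s))
      (riemannZeta s)⁻¹ := by
  have h := (ArithmeticFunction.LSeriesSummable_moebius_iff.2 hs).LSeriesHasSum
  have e : LSeries (fun n => (ArithmeticFunction.moebius n : ℂ)) s = (riemannZeta s)⁻¹ := by
    rw [← ArithmeticFunction.LSeries_zeta_eq_riemannZeta hs]
    exact eq_inv_of_mul_eq_one_right (ArithmeticFunction.LSeries_zeta_mul_Lseries_moebius hs)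
  rw [← e]
  refine h.congr_fun fun n => ?_
  rcases eq_or_ne n 0 with rfl | hn
  · simp
  · rw [LSeries.term_of_ne_zero hn, cpow_neg, div_eq_mul_inv]

lemma ae_zeta₁_one_add_edgePt_ne_zero :
    ∀ᵐ ξ : ℝ, riemannZeta₁ (1 + edgePt ξ) ≠ 0 := by
  have hc : riemannZetaZeros.Countable :=
    (HereditarilyLindelofSpace.isLindelof _).countable_of_isDiscrete isDiscrete_riemannZetaZeros
  have hinj : Function.Injective fun ξ : ℝ => 1 + edgePt ξ := fun a b hab => by
    have := congrArg im hab
    simpa [edgePt_im, Real.pi_ne_zero] using this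
  refine ((hc.preimage hinj).ae_notMem volume).mono fun ξ hξ h0 => hξ ?_
  have h1 : (1 : ℂ) + edgePt ξ ≠ 1 := fun h => edgePt_ne_zero ξ (by simpa using h)
  rw [zeta₁_eq_sub_one_mul h1, add_sub_cancel_left] at h0
  exact (mul_eq_zero.1 h0).resolve_left (edgePt_ne_zero ξ)

lemma memLp_growth_div_edgePt :
    MemLp (fun ξ : ℝ => (7 + |2 * Real.pi * ξ|) ^ (5 / 12 : ℝ) / ‖edgePt ξ‖) 2 := by
  have hcont : Continuous fun ξ : ℝ => (7 + |2 * Real.pi * ξ|) ^ (5 / 12 : ℝ) / ‖edgePt ξ‖ := by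
    refine Continuous.div ?_ continuous_edgePt.norm fun ξ => norm_ne_zero_iff.2 (edgePt_ne_zero ξ)
    exact Continuous.rpow_const (by fun_prop) fun ξ => Or.inl (by positivity)
  refine (memLp_two_iff_integrable_sq hcont.aestronglyMeasurable).2 ?_
  have hint := (integrable_rpow_neg_one_add_norm_sq (E := ℝ) (μ := volume) (r := 7 / 6)
    (by norm_num)).const_mul (15 ^ (5 / 6 : ℝ) * 4 ^ (7 / 12 : ℝ))
  refine hint.mono' (hcont.pow 2).aestronglyMeasurable (Filter.Eventually.of_forall fun ξ => ?_)
  have hs : 0 < ‖edgePt ξ‖ := norm_pos_iff.2 (edgePt_ne_zero ξ)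
  have h1 := half_le_norm_edgePt ξ
  have h2 : |2 * Real.pi * ξ| ≤ ‖edgePt ξ‖ := by
    have := abs_im_le_norm (edgePt ξ)
    rwa [edgePt_im] at this
  have h3 : (1 + ‖ξ‖ ^ 2) / 4 ≤ ‖edgePt ξ‖ ^ 2 := by
    rw [norm_edgePt_sq, Real.norm_eq_abs, sq_abs]
    rw [mul_pow]
    have h4 : 1 ≤ (2 * Real.pi) ^ 2 := one_le_pow₀ (by linarith [Real.pi_gt_three])
    nlinarith [sq_nonneg ξ]
  rw [Real.norm_of_nonneg (by positivity), div_pow]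
  have e1 : ((7 + |2 * Real.pi * ξ|) ^ (5 / 12 : ℝ)) ^ 2 = (7 + |2 * Real.pi * ξ|) ^ (5 / 6 : ℝ) := by
    rw [← Real.rpow_two, ← Real.rpow_mul (by positivity)]
    norm_num
  rw [e1]
  calc _ ≤ (15 * ‖edgePt ξ‖) ^ (5 / 6 : ℝ) / ‖edgePt ξ‖ ^ 2 := by
        gcongr
        linarith
    _ = 15 ^ (5 / 6 : ℝ) * (‖edgePt ξ‖ ^ 2) ^ (-(7 / 6) / 2 : ℝ) := by
        rw [Real.mul_rpow (by norm_num) hs.le, mul_div_assoc, ← Real.rpow_two,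
          ← Real.rpow_sub hs, ← Real.rpow_mul hs.le]
        norm_num
    _ ≤ 15 ^ (5 / 6 : ℝ) * ((1 + ‖ξ‖ ^ 2) / 4) ^ (-(7 / 6) / 2 : ℝ) := by
        refine mul_le_mul_of_nonneg_left ?_ (by positivity)
        exact Real.rpow_le_rpow_of_nonpos (by positivity) h3 (by norm_num)
    _ = _ := by
        rw [Real.div_rpow (by positivity) (by norm_num),
          show (7 / 12 : ℝ) = -(-(7 / 6) / 2) by norm_num,
          Real.rpow_neg (by norm_num : (0 : ℝ) ≤ 4)]
        ring

lemma memLp_zeta_div_edgePt :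
    MemLp (fun ξ : ℝ => riemannZeta (1 + edgePt ξ) / edgePt ξ) 2 := by
  have h := (memLp_congr_ae (edgeIso_hSeq (k := 2) (by norm_num))).1 (Lp.memLp _)
  have hne : ∀ ξ : ℝ, 1 / 3 ≤ ‖1 - ((2 : ℕ) : ℂ) ^ (-edgePt ξ)‖ := fun ξ => by
    have h1 := norm_sub_norm_le (((2 : ℕ) : ℂ) ^ (-edgePt ξ)) 1
    rw [norm_natCast_cpow_of_pos (by norm_num), norm_one, neg_re, edgePt_re, norm_sub_rev] at h1
    refine le_trans ?_ h1
    have h2 : (4 / 3 : ℝ) ≤ ((2 : ℕ) : ℝ) ^ (- -(1 / 2) : ℝ) := by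
      rw [neg_neg, ← Real.sqrt_eq_rpow]
      exact Real.le_sqrt_of_sq_le (by norm_num)
    linarith
  refine h.of_le_mul (c := 3) ?_ (Filter.Eventually.of_forall fun ξ => ?_)
  · refine Continuous.aestronglyMeasurable (Continuous.div ?_ continuous_edgePt edgePt_ne_zero)
    refine continuous_iff_continuousAt.2 fun ξ => ?_
    refine ContinuousAt.comp (f := fun ξ => 1 + edgePt ξ) (g := riemannZeta) ?_
      (by have := continuous_edgePt; fun_prop)
    exact (differentiableAt_riemannZeta fun h => edgePt_ne_zero ξ (by simpa using h)).continuousAt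
  · rw [norm_mul]
    nlinarith [hne ξ, norm_nonneg (riemannZeta (1 + edgePt ξ) / edgePt ξ)]

/-- `ζ(w) / (s ζ(w + u))` on the line `w = 1 + s`, `s = edgePt ξ`, written without poles. -/
noncomputable def edgeKernel (u : ℂ) (ξ : ℝ) : ℂ :=
  riemannZeta₁ (1 + edgePt ξ) / riemannZeta₁ (1 + edgePt ξ + u) *
    ((edgePt ξ + u) / edgePt ξ ^ 2)

lemma zeta₁_one_add_edgePt_add_ne_zero (hRH : RiemannHypothesis) {u : ℂ} (hu : 0 < u.re) (ξ : ℝ) :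
    riemannZeta₁ (1 + edgePt ξ + u) ≠ 0 :=
  zeta₁_ne_zero hRH (by simp [edgePt_re]; linarith)

lemma continuous_edgeKernel (hRH : RiemannHypothesis) {u : ℂ} (hu : 0 < u.re) :
    Continuous (edgeKernel u) := by
  have h1 := continuous_edgePt
  have h2 := differentiable_riemannZeta₁.continuous
  refine Continuous.mul (Continuous.div (by fun_prop) (by fun_prop)
    (zeta₁_one_add_edgePt_add_ne_zero hRH hu)) (Continuous.div (by fun_prop) (by fun_prop)
    fun ξ => pow_ne_zero 2 (edgePt_ne_zero ξ))

lemma differentiableAt_edgeKernel (hRH : RiemannHypothesis) {u : ℂ} (hu : 0 < u.re) (ξ : ℝ) :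
    DifferentiableAt ℂ (fun u => edgeKernel u ξ) u := by
  have h := differentiable_riemannZeta₁
  have h1 : DifferentiableAt ℂ (fun u => riemannZeta₁ (1 + edgePt ξ + u)) u :=
    (h _).comp u (by fun_prop)
  unfold edgeKernel
  exact ((differentiableAt_const _).div h1 (zeta₁_one_add_edgePt_add_ne_zero hRH hu ξ)).mul
    (by fun_prop)

lemma edgeKernel_eq {u : ℂ} (hu : 1 / 2 < u.re) (ξ : ℝ) :
    edgeKernel u ξ =
      riemannZeta (1 + edgePt ξ) / edgePt ξ * (riemannZeta (1 + edgePt ξ + u))⁻¹ := by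
  have h0 := edgePt_ne_zero ξ
  have h2 : edgePt ξ + u ≠ 0 := fun h => by
    have := congrArg re h
    simp [edgePt_re] at this
    linarith
  have h1 : (1 : ℂ) + edgePt ξ ≠ 1 := fun h => h0 (by simpa using h)
  have h3 : (1 : ℂ) + edgePt ξ + u ≠ 1 := fun h => h2 (by simpa [add_assoc] using h)
  rw [edgeKernel, zeta₁_eq_sub_one_mul h1, zeta₁_eq_sub_one_mul h3,
    show (1 : ℂ) + edgePt ξ - 1 = edgePt ξ by ring,
    show (1 : ℂ) + edgePt ξ + u - 1 = edgePt ξ + u by ring, mul_div_mul_comm, ← div_eq_mul_inv]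
  field_simp

lemma norm_edgePt_add_div_le {u : ℂ} (hu : ‖u‖ ≤ 1) (ξ : ℝ) :
    ‖(edgePt ξ + u) / edgePt ξ ^ 2‖ ≤ 3 * ‖edgePt ξ‖⁻¹ := by
  have h1 := half_le_norm_edgePt ξ
  have h0 : 0 < ‖edgePt ξ‖ := by linarith
  rw [norm_div, norm_pow, div_le_iff₀ (by positivity)]
  calc _ ≤ ‖edgePt ξ‖ + ‖u‖ := norm_add_le _ _
    _ ≤ 3 * ‖edgePt ξ‖ := by linarith
    _ = _ := by field_simp

lemma exists_norm_zeta₁_ratio_le (hRH : RiemannHypothesis) : ∃ K : ℝ, 0 < K ∧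
    ∀ ε : ℝ, 0 < ε → ε ≤ 2 / 3 → ∀ ξ : ℝ,
      ‖riemannZeta₁ (1 + edgePt ξ) / riemannZeta₁ (1 + edgePt ξ + ε)‖ ≤
        K * (7 + |2 * Real.pi * ξ|) ^ (1 / 3 : ℝ) := by
  obtain ⟨C, hC, h⟩ := exists_norm_zeta₁_div_pow_le hRH
  refine ⟨C ^ (1 / 3 : ℝ), by positivity, fun ε hε0 hε1 ξ => ?_⟩
  have h1 := h ε (1 + edgePt ξ) hε0 hε1 (by simp [edgePt_re]; norm_num)
  have h2 : ‖(1 : ℂ) + edgePt ξ + 2‖ ≤ 7 + |2 * Real.pi * ξ| := by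
    have := norm_le_abs_re_add_abs_im ((1 : ℂ) + edgePt ξ + 2)
    simp only [add_re, add_im, one_re, one_im, edgePt_re, edgePt_im, re_ofNat, im_ofNat] at this
    norm_num at this
    rw [abs_mul, abs_mul, abs_two]
    linarith
  rw [← Real.mul_rpow hC.le (by positivity), one_div]
  refine (Real.le_rpow_inv_iff_of_pos (norm_nonneg _) (by positivity)
    (by norm_num : (0 : ℝ) < 3)).2 ?_
  rw [show (3 : ℝ) = ((3 : ℕ) : ℝ) by norm_num, Real.rpow_natCast]
  exact h1.trans (by gcongr)

lemma exists_norm_edgeKernel_ofReal_le (hRH : RiemannHypothesis) : ∃ K : ℝ,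
    ∀ ε : ℝ, 0 < ε → ε ≤ 2 / 3 → ∀ ξ : ℝ, ‖edgeKernel ε ξ‖ ≤
      K * ((7 + |2 * Real.pi * ξ|) ^ (5 / 12 : ℝ) / ‖edgePt ξ‖) := by
  obtain ⟨K, hK, h⟩ := exists_norm_zeta₁_ratio_le hRH
  refine ⟨K * 3, fun ε hε0 hε1 ξ => ?_⟩
  have h1 := norm_edgePt_add_div_le (u := ε)
    (by rw [norm_real, Real.norm_of_nonneg hε0.le]; linarith) ξ
  rw [edgeKernel, norm_mul]
  calc _ ≤ (K * (7 + |2 * Real.pi * ξ|) ^ (1 / 3 : ℝ)) * (3 * ‖edgePt ξ‖⁻¹) := by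
        gcongr
        exact h ε hε0 hε1 ξ
    _ ≤ (K * (7 + |2 * Real.pi * ξ|) ^ (5 / 12 : ℝ)) * (3 * ‖edgePt ξ‖⁻¹) := by
        gcongr ?_ * ?_ * _
        exact Real.rpow_le_rpow_of_exponent_le (by linarith [abs_nonneg (2 * Real.pi * ξ)])
          (by norm_num)
    _ = _ := by ring

lemma exists_norm_edgeKernel_ball_le (hRH : RiemannHypothesis) {ε : ℝ} (hε0 : 0 < ε)
    (hε1 : ε ≤ 2 / 3) : ∃ K r : ℝ, 0 < r ∧ (∀ u ∈ Metric.ball (ε : ℂ) r, 0 < u.re) ∧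
      ∀ u ∈ Metric.ball (ε : ℂ) r, ∀ ξ : ℝ, ‖edgeKernel u ξ‖ ≤
        K * ((7 + |2 * Real.pi * ξ|) ^ (5 / 12 : ℝ) / ‖edgePt ξ‖) := by
  obtain ⟨K, hK, h⟩ := exists_norm_zeta₁_ratio_le hRH
  obtain ⟨A, hA, hd⟩ := exists_norm_zeta₁_div_le hRH (δ := ε / 3) (by linarith)
  have hr : 0 < min (ε / 3) (1 / (12 * (A + 1))) := by positivity
  refine ⟨K * 3, min (ε / 3) (1 / (12 * (A + 1))), hr, fun u hu => ?_, fun u hu ξ => ?_⟩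
  · rw [Metric.mem_ball, dist_eq_norm] at hu
    have h1 := (abs_re_le_norm (u - ε)).trans (hu.le.trans (min_le_left _ _))
    rw [sub_re, ofReal_re, abs_le] at h1
    linarith [h1.1]
  · rw [Metric.mem_ball, dist_eq_norm] at hu
    have hu1 : ‖u - ε‖ ≤ ε / 3 := hu.le.trans (min_le_left _ _)
    have hu2 : ‖u - ε‖ ≤ 1 / (12 * (A + 1)) := hu.le.trans (min_le_right _ _)
    have hun : ‖u‖ ≤ 1 := by
      have := norm_add_le (u - ε) (ε : ℂ)
      rw [sub_add_cancel, norm_real, Real.norm_of_nonneg hε0.le] at this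
      linarith
    have hne := zeta₁_one_add_edgePt_add_ne_zero hRH (u := (ε : ℂ)) (by simpa using hε0) ξ
    have h1 := norm_edgePt_add_div_le hun ξ
    have h2 := h ε hε0 hε1 ξ
    have e : (1 : ℂ) + edgePt ξ + ε - (1 + edgePt ξ + u) = -(u - ε) := by ring
    have h3 := hd (1 + edgePt ξ + ε) (1 + edgePt ξ + u) (by simp [edgePt_re]; linarith)
      (by simp [edgePt_re]; linarith) (by rwa [e, norm_neg])
    have him : ((1 : ℂ) + edgePt ξ + ε).im = 2 * Real.pi * ξ := by simp [edgePt_im]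
    rw [e, norm_neg, him] at h3
    have h7 : 1 ≤ 7 + |2 * Real.pi * ξ| := by linarith [abs_nonneg (2 * Real.pi * ξ)]
    have h4 : (7 + |2 * Real.pi * ξ|) ^ (A * ‖u - ε‖) ≤
        (7 + |2 * Real.pi * ξ|) ^ (1 / 12 : ℝ) := by
      refine Real.rpow_le_rpow_of_exponent_le h7 ?_
      calc _ ≤ A * (1 / (12 * (A + 1))) := by gcongr
        _ ≤ 1 / 12 := by
          rw [mul_one_div, div_le_div_iff₀ (by positivity) (by norm_num)]
          linarith
    rw [edgeKernel, norm_mul]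
    have e2 : riemannZeta₁ (1 + edgePt ξ) / riemannZeta₁ (1 + edgePt ξ + u) =
        riemannZeta₁ (1 + edgePt ξ) / riemannZeta₁ (1 + edgePt ξ + ε) *
          (riemannZeta₁ (1 + edgePt ξ + ε) / riemannZeta₁ (1 + edgePt ξ + u)) :=
      (div_mul_div_cancel₀ hne).symm
    rw [e2, norm_mul]
    calc _ ≤ (K * (7 + |2 * Real.pi * ξ|) ^ (1 / 3 : ℝ) *
          (7 + |2 * Real.pi * ξ|) ^ (1 / 12 : ℝ)) * (3 * ‖edgePt ξ‖⁻¹) := by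
          gcongr
          exact h3.trans h4
      _ = _ := by
          rw [mul_assoc K, ← Real.rpow_add (by linarith)]
          norm_num
          ring

lemma integral_mul_edgeKernel_of_half_lt {F : ℝ → ℂ} (hF : MemLp F 2 volume)
    (hk : ∀ k : ℕ, 2 ≤ k → ∫ ξ : ℝ, F ξ * (riemannZeta (1 + edgePt ξ) / edgePt ξ *
      (1 - (k : ℂ) ^ (-edgePt ξ))) = 0) {ε : ℝ} (hε : 1 / 2 < ε) :
    ∫ ξ : ℝ, F ξ * edgeKernel ε ξ =
      (∫ ξ : ℝ, F ξ * (riemannZeta (1 + edgePt ξ) / edgePt ξ)) * (riemannZeta (1 + ε))⁻¹ := by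
  set Φ : ℝ → ℂ := fun ξ => F ξ * (riemannZeta (1 + edgePt ξ) / edgePt ξ) with hΦ
  have hΦint : Integrable Φ := hF.integrable_mul memLp_zeta_div_edgePt
  have hΦk : ∀ k : ℕ, Integrable fun ξ => Φ ξ * (k : ℂ) ^ (-edgePt ξ) := fun k =>
    hΦint.mul_bdd (continuous_natCast_cpow_neg_edgePt k).aestronglyMeasurable
      (Filter.Eventually.of_forall (norm_natCast_cpow_neg_edgePt_le k))
  have hmom : ∀ k : ℕ, 0 < k → ∫ ξ, Φ ξ * (k : ℂ) ^ (-edgePt ξ) = ∫ ξ, Φ ξ := fun k hk0 => by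
    rcases eq_or_lt_of_le (Nat.succ_le_of_lt hk0) with rfl | h2
    · simp
    · have h := hk k h2
      have e : ∀ ξ, F ξ * (riemannZeta (1 + edgePt ξ) / edgePt ξ *
          (1 - (k : ℂ) ^ (-edgePt ξ))) = Φ ξ - Φ ξ * (k : ℂ) ^ (-edgePt ξ) := fun ξ => by
        simp only [hΦ]; ring
      simp only [e] at h
      rw [integral_sub hΦint (hΦk k), sub_eq_zero] at h
      exact h.symm
  set a : ℕ → ℂ := fun n => (ArithmeticFunction.moebius n : ℂ) * (n : ℂ) ^ (-(1 + ε : ℂ)) with ha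
  have hsplit : ∀ (n : ℕ) (ξ : ℝ), (ArithmeticFunction.moebius n : ℂ) *
      (n : ℂ) ^ (-(1 + edgePt ξ + ε)) = a n * (n : ℂ) ^ (-edgePt ξ) := fun n ξ => by
    rcases Nat.eq_zero_or_pos n with rfl | hn
    · simp [ha]
    · rw [ha]
      simp only
      rw [mul_assoc, ← cpow_add _ _ (by exact_mod_cast hn.ne')]
      congr 2
      ring
  have hpt : ∀ ξ : ℝ, HasSum (fun n : ℕ => Φ ξ * (n : ℂ) ^ (-edgePt ξ) * a n)
      (F ξ * edgeKernel ε ξ) := fun ξ => by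
    have h := (hasSum_inv_zeta (s := 1 + edgePt ξ + ε) (by simp [edgePt_re]; linarith)).mul_left
      (Φ ξ)
    simp only [hsplit] at h
    rw [edgeKernel_eq (by simpa using hε), ← mul_assoc]
    refine h.congr_fun fun n => ?_
    ring
  have hna : ∀ n : ℕ, ‖a n‖ * (n : ℝ) ^ (1 / 2 : ℝ) ≤ (n : ℝ) ^ (-(1 / 2 + ε)) := fun n => by
    rcases Nat.eq_zero_or_pos n with rfl | hn
    · simp [ha]
      positivity
    · have hn' : (0 : ℝ) < n := by exact_mod_cast hn
      have hmu : ‖(ArithmeticFunction.moebius n : ℂ)‖ ≤ 1 := by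
        rw [norm_intCast]
        exact_mod_cast ArithmeticFunction.abs_moebius_le_one
      rw [ha]
      simp only
      rw [norm_mul, norm_natCast_cpow_of_pos hn, mul_assoc]
      refine (mul_le_of_le_one_left (by positivity) hmu).trans_eq ?_
      rw [← Real.rpow_add hn']
      congr 1
      simp
      ring
  have hsum : Summable fun n : ℕ => ∫ ξ, ‖Φ ξ * (n : ℂ) ^ (-edgePt ξ) * a n‖ := by
    refine Summable.of_nonneg_of_le (fun n => integral_nonneg fun ξ => norm_nonneg _)
      (fun n => ?_) ((Real.summable_nat_rpow.2 (by linarith : -(1 / 2 + ε) < -1)).mul_left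
        (∫ ξ, ‖Φ ξ‖))
    rw [← integral_mul_const]
    refine integral_mono (((hΦk n).mul_const _).norm) (hΦint.norm.mul_const _) fun ξ => ?_
    simp only [norm_mul _ (a n), norm_mul (Φ ξ)]
    calc _ ≤ ‖Φ ξ‖ * (n : ℝ) ^ (1 / 2 : ℝ) * ‖a n‖ := by
          gcongr
          exact norm_natCast_cpow_neg_edgePt_le n ξ
      _ = ‖Φ ξ‖ * (‖a n‖ * (n : ℝ) ^ (1 / 2 : ℝ)) := by ring
      _ ≤ _ := by gcongr; exact hna n
  have h1 := hasSum_integral_of_summable_integral_norm (fun n => (hΦk n).mul_const (a n)) hsum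
  simp only [(hpt _).tsum_eq, integral_mul_const] at h1
  have h2 := (hasSum_inv_zeta (s := 1 + ε) (by simp; linarith)).mul_left (∫ ξ, Φ ξ)
  refine h1.unique (h2.congr_fun fun n => ?_)
  rcases Nat.eq_zero_or_pos n with rfl | hn
  · simp [ha]
  · rw [hmom n hn]

lemma integral_mul_edgeKernel_eq (hRH : RiemannHypothesis) {F : ℝ → ℂ} (hF : MemLp F 2 volume)
    (hk : ∀ k : ℕ, 2 ≤ k → ∫ ξ : ℝ, F ξ * (riemannZeta (1 + edgePt ξ) / edgePt ξ *
      (1 - (k : ℂ) ^ (-edgePt ξ))) = 0) {ε : ℝ} (hε0 : 0 < ε) (hε1 : ε < 2 / 3) :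
    ∫ ξ : ℝ, F ξ * edgeKernel ε ξ =
      (∫ ξ : ℝ, F ξ * (riemannZeta (1 + edgePt ξ) / edgePt ξ)) *
        (ε * (riemannZeta₁ (1 + ε))⁻¹) := by
  set c := ∫ ξ : ℝ, F ξ * (riemannZeta (1 + edgePt ξ) / edgePt ξ) with hc
  set B : ℂ → ℂ := fun u => ∫ ξ : ℝ, F ξ * edgeKernel u ξ with hB
  set g : ℂ → ℂ := fun u => c * (u * (riemannZeta₁ (1 + u))⁻¹) with hg
  set U : Set ℂ := ofReal '' Set.Ioo (0 : ℝ) (2 / 3) with hU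
  have hBan : AnalyticOnNhd ℂ B U := by
    rintro _ ⟨x, hx, rfl⟩
    obtain ⟨K, r, hr, hre, hle⟩ := exists_norm_edgeKernel_ball_le hRH hx.1 hx.2.le
    refine DifferentiableOn.analyticAt (s := Metric.ball (x : ℂ) r) ?_
      (Metric.ball_mem_nhds _ hr)
    refine differentiableOn_integral_of_dominated
      (bound := fun ξ => ‖F ξ‖ * (K * ((7 + |2 * Real.pi * ξ|) ^ (5 / 12 : ℝ) / ‖edgePt ξ‖)))
      (fun u hu => ?_) ?_ (fun u hu ξ => ?_) (fun ξ u hu => ?_)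
    · exact hF.1.mul (continuous_edgeKernel hRH (hre u hu)).aestronglyMeasurable
    · exact hF.norm.integrable_mul (memLp_growth_div_edgePt.const_mul K)
    · rw [norm_mul]
      gcongr
      exact hle u hu ξ
    · exact ((differentiableAt_edgeKernel hRH (hre u hu) ξ).const_mul _).differentiableWithinAt
  have hgan : AnalyticOnNhd ℂ g U := by
    rintro _ ⟨x, hx, rfl⟩
    have hne : riemannZeta₁ (1 + x) ≠ 0 :=
      zeta₁_ne_zero hRH (by simp; linarith [hx.1])
    have hd : Differentiable ℂ fun u : ℂ => riemannZeta₁ (1 + u) :=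
      differentiable_riemannZeta₁.comp (by fun_prop)
    exact analyticAt_const.mul (analyticAt_id.mul ((hd.analyticAt _).inv hne))
  have hUc : IsPreconnected U :=
    isPreconnected_Ioo.image _ continuous_ofReal.continuousOn
  have hagree : ∀ x : ℝ, 1 / 2 < x → B x = g x := fun x hx => by
    have h1 : (1 : ℂ) + x ≠ 1 := fun h => by
      have : (x : ℂ) = 0 := by simpa using h
      rw [ofReal_eq_zero] at this
      linarith
    rw [hB, hg]
    simp only
    rw [integral_mul_edgeKernel_of_half_lt hF hk hx, zeta₁_eq_sub_one_mul h1,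
      add_sub_cancel_left, mul_inv, mul_inv_cancel_left₀ (by simpa using h1)]
  have hfreq : ∃ᶠ z in nhdsWithin ((3 / 5 : ℝ) : ℂ) {((3 / 5 : ℝ) : ℂ)}ᶜ, B z = g z := by
    have ht : Filter.Tendsto ofReal (nhdsWithin (3 / 5 : ℝ) {(3 / 5 : ℝ)}ᶜ)
        (nhdsWithin ((3 / 5 : ℝ) : ℂ) {((3 / 5 : ℝ) : ℂ)}ᶜ) :=
      (continuous_ofReal.continuousAt.tendsto).inf
        (Filter.tendsto_principal_principal.2 fun a ha h => ha (ofReal_injective h))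
    refine ht.frequently (Filter.Eventually.frequently ?_)
    filter_upwards [mem_nhdsWithin_of_mem_nhds (lt_mem_nhds (by norm_num : (1 / 2 : ℝ) < 3 / 5))]
      with x hx using hagree x hx
  exact hBan.eqOn_of_preconnected_of_frequently_eq hgan hUc
    (Set.mem_image_of_mem _ ⟨by norm_num, by norm_num⟩) hfreq (Set.mem_image_of_mem _ ⟨hε0, hε1⟩)

lemma integral_mul_inv_edgePt_eq_zero (hRH : RiemannHypothesis) {F : ℝ → ℂ}
    (hF : MemLp F 2 volume)
    (hk : ∀ k : ℕ, 2 ≤ k → ∫ ξ : ℝ, F ξ * (riemannZeta (1 + edgePt ξ) / edgePt ξ *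
      (1 - (k : ℂ) ^ (-edgePt ξ))) = 0) :
    ∫ ξ : ℝ, F ξ * (edgePt ξ)⁻¹ = 0 := by
  obtain ⟨K, hK⟩ := exists_norm_edgeKernel_ofReal_le hRH
  have hmem : ∀ᶠ ε : ℝ in nhdsWithin 0 (Set.Ioi 0), ε ∈ Set.Ioo (0 : ℝ) (2 / 3) :=
    Ioo_mem_nhdsGT (by norm_num)
  have hlim : Filter.Tendsto (fun ε : ℝ => ∫ ξ : ℝ, F ξ * edgeKernel ε ξ)
      (nhdsWithin 0 (Set.Ioi 0)) (nhds (∫ ξ : ℝ, F ξ * (edgePt ξ)⁻¹)) := by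
    refine tendsto_integral_filter_of_dominated_convergence
      (fun ξ => ‖F ξ‖ * (K * ((7 + |2 * Real.pi * ξ|) ^ (5 / 12 : ℝ) / ‖edgePt ξ‖))) ?_ ?_
      (hF.norm.integrable_mul (memLp_growth_div_edgePt.const_mul K)) ?_
    · filter_upwards [hmem] with ε hε
      exact hF.1.mul (continuous_edgeKernel hRH (by simpa using hε.1)).aestronglyMeasurable
    · filter_upwards [hmem] with ε hε
      refine Filter.Eventually.of_forall fun ξ => ?_
      rw [norm_mul]
      gcongr
      exact hK ε hε.1 hε.2.le ξ
    · filter_upwards [ae_zeta₁_one_add_edgePt_ne_zero] with ξ hξ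
      have h0 := edgePt_ne_zero ξ
      have hc : ContinuousAt (fun ε : ℝ => F ξ * edgeKernel ε ξ) 0 := by
        unfold edgeKernel
        have hd := differentiable_riemannZeta₁.continuous
        refine continuousAt_const.mul (ContinuousAt.mul (ContinuousAt.div continuousAt_const ?_ ?_)
          ?_)
        · exact (hd.comp (by fun_prop :
            Continuous fun ε : ℝ => 1 + edgePt ξ + (ε : ℂ))).continuousAt
        · simpa using hξ
        · exact (by fun_prop : Continuous fun ε : ℝ =>
            (edgePt ξ + (ε : ℂ)) / edgePt ξ ^ 2).continuousAt
      have h1 := hc.tendsto.mono_left (nhdsWithin_le_nhds (s := Set.Ioi (0 : ℝ)))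
      have e : F ξ * edgeKernel ((0 : ℝ) : ℂ) ξ = F ξ * (edgePt ξ)⁻¹ := by
        rw [edgeKernel, ofReal_zero, add_zero, add_zero, div_self hξ, one_mul]
        field_simp
      rwa [e] at h1
  have hlim' : Filter.Tendsto (fun ε : ℝ => ∫ ξ : ℝ, F ξ * edgeKernel ε ξ)
      (nhdsWithin 0 (Set.Ioi 0)) (nhds 0) := by
    set c := ∫ ξ : ℝ, F ξ * (riemannZeta (1 + edgePt ξ) / edgePt ξ)
    have hc : ContinuousAt (fun ε : ℝ => c * (ε * (riemannZeta₁ (1 + ε))⁻¹)) 0 := by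
      have hd := differentiable_riemannZeta₁.continuous
      refine continuousAt_const.mul (continuous_ofReal.continuousAt.mul (ContinuousAt.inv₀ ?_ ?_))
      · exact (hd.comp (by fun_prop : Continuous fun ε : ℝ => 1 + (ε : ℂ))).continuousAt
      · simp
    have h1 := hc.tendsto.mono_left (nhdsWithin_le_nhds (s := Set.Ioi (0 : ℝ)))
    simp only [ofReal_zero, zero_mul, mul_zero] at h1
    refine h1.congr' ?_
    filter_upwards [hmem] with ε hε
    exact (integral_mul_edgeKernel_eq hRH hF hk hε.1 hε.2).symm
  exact tendsto_nhds_unique hlim hlim'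

/-- The Riemann Hypothesis holds if and only if the closure of
`𝒩 = span{h_k : k ≥ 2}` in `H²` is invariant under the shift `(Sf)(ω) = ω·f(ω)`. -/
theorem rh_iff_closure_N_shift_invariant
    (hk : ℕ → Lp ℂ 2 mCirc)
    (hk_ae : ∀ k, 2 ≤ k → (hk k : ℂ → ℂ) =ᵐ[mCirc] hFun k)
    (hk_mem : ∀ k, 2 ≤ k → hk k ∈ H2) :
    RiemannHypothesis ↔
      (∀ f ∈ closure ((Submodule.span ℂ (hk '' {k : ℕ | 2 ≤ k}) :
          Submodule ℂ (Lp ℂ 2 mCirc)) : Set (Lp ℂ 2 mCirc)),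
        ∀ g : Lp ℂ 2 mCirc, (g : ℂ → ℂ) =ᵐ[mCirc] (fun ω => ω * f ω) →
          g ∈ closure ((Submodule.span ℂ (hk '' {k : ℕ | 2 ≤ k}) :
            Submodule ℂ (Lp ℂ 2 mCirc)) : Set (Lp ℂ 2 mCirc))) := by
  exact shift_invariant_iff_of hk_ae fun hRH n => single_mem_hSpan_of
    (fun _ hF hF0 => integral_mul_inv_edgePt_eq_zero hRH hF hF0) n
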